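/- arXiv:2503.10113 — 3 statements merged into one kernel-verified Lean document; each statement's English description precedes it below -/
import Mathlib

section
/- For all integers n ≥ 0, β ≥ 0, k ≥ 1 and every r ∈ {2, 3, 4}, the number 24 divides (24r+18)·5^{2k+β-1} + 5^{2k-1} + 1, and p_{1,5^{2k-1}}(5^{2k+β}·n + ((24r+18)·5^{2k+β-1} + 5^{2k-1} + 1)/24) ≡ 0 (mod 5^{2k+β}). -/
open PowerSeries


/-- Number of 2-color partitions of `n` in which the second color is used only on
parts that are multiples of `ℓ`: pairs `(λ, μ)` of partitions with `|λ| + |μ| = n`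
and every part of `μ` divisible by `ℓ`. -/
def p1 (ℓ n : ℕ) : ℕ :=
  ∑ a ∈ Finset.range (n + 1),
    Fintype.card (Nat.Partition a) *
      Fintype.card {μ : Nat.Partition (n - a) // ∀ i ∈ μ.parts, ℓ ∣ i}

namespace EulerSeries

/-- The part of a power series supported on exponents congruent to `i` modulo `5`. -/
noncomputable def part (i : ℕ) (f : ℤ⟦X⟧) : ℤ⟦X⟧ :=
  .mk fun n ↦ if n % 5 = i then coeff n f else 0

theorem pentagonal_mod_five (k : ℤ) :
    pentagonal k % 5 = if k % 5 = 1 then 1 else if k % 5 = 0 ∨ k % 5 = 2 then 0 else 2 := by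
  have h := two_mul_natCast_pentagonal k
  obtain ⟨q, hq⟩ : ∃ q, q = k / 5 := ⟨_, rfl⟩
  have h5 : k % 5 = 0 ∨ k % 5 = 1 ∨ k % 5 = 2 ∨ k % 5 = 3 ∨ k % 5 = 4 := by omega
  generalize pentagonal k = p at h ⊢
  rcases h5 with h5 | h5 | h5 | h5 | h5
  · obtain rfl : k = 5 * q := by omega
    ring_nf at h
    simp only [h5]; norm_num; omega
  · obtain rfl : k = 5 * q + 1 := by omega
    ring_nf at h
    simp only [h5]; norm_num; omega
  · obtain rfl : k = 5 * q + 2 := by omega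
    ring_nf at h
    simp only [h5]; norm_num; omega
  · obtain rfl : k = 5 * q + 3 := by omega
    ring_nf at h
    simp only [h5]; norm_num; omega
  · obtain rfl : k = 5 * q + 4 := by omega
    ring_nf at h
    simp only [h5]; norm_num; omega

theorem abs_le_pentagonal (k : ℤ) : |k| ≤ pentagonal k := by
  have h := two_mul_natCast_pentagonal k
  rcases abs_cases k with ⟨h1, h2⟩ | ⟨h1, h2⟩
  · rcases eq_or_ne k 0 with rfl | h0
    · simp
    · have : 1 ≤ k := by omega
      nlinarith
  · nlinarith

/-- The pairs of indices `(k, l)` whose pentagonal numbers sum to `N`. -/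
noncomputable def pairs (N : ℕ) : Finset (ℤ × ℤ) :=
  ((Finset.Icc (-N : ℤ) N) ×ˢ (Finset.Icc (-N : ℤ) N)).filter
    fun x ↦ pentagonal x.1 + pentagonal x.2 = N

theorem mem_pairs {N : ℕ} {x : ℤ × ℤ} :
    x ∈ pairs N ↔ pentagonal x.1 + pentagonal x.2 = N := by
  simp only [pairs, Finset.mem_filter, Finset.mem_product, Finset.mem_Icc, and_iff_right_iff_imp]
  intro h
  have h1 := abs_le.mp (abs_le_pentagonal x.1)
  have h2 := abs_le.mp (abs_le_pentagonal x.2)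
  omega

theorem sum_antidiagonal_pentagonalSeries (w : ℕ → ℕ → ℤ) (N : ℕ) :
    ∑ x ∈ Finset.HasAntidiagonal.antidiagonal N, w x.1 x.2 *
      (coeff x.1 (pentagonalSeries ℤ) * coeff x.2 (pentagonalSeries ℤ)) =
    ∑ x ∈ pairs N, w (pentagonal x.1) (pentagonal x.2) * Int.negOnePow (x.1 + x.2) := by
  symm
  refine Finset.sum_of_injOn (fun x ↦ (pentagonal x.1, pentagonal x.2)) ?_ ?_ ?_ ?_
  · rintro ⟨a, b⟩ - ⟨c, d⟩ - h
    simpa using h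
  · intro x hx
    simpa [mem_pairs] using hx
  · rintro ⟨x, y⟩ hx hxy
    by_cases h1 : x ∈ Set.range pentagonal
    · by_cases h2 : y ∈ Set.range pentagonal
      · obtain ⟨k, rfl⟩ := h1
        obtain ⟨l, rfl⟩ := h2
        exact absurd ⟨(k, l), by simpa [mem_pairs] using hx, rfl⟩ hxy
      · simp [coeff_pentagonalSeries_eq_zero ℤ h2]
    · simp [coeff_pentagonalSeries_eq_zero ℤ h1]
  · rintro ⟨k, l⟩ -
    simp only [coeff_pentagonalSeries_pentagonal, Int.negOnePow_add, Units.val_mul, Int.cast_id]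

theorem sum_pairs_eq_zero (N : ℕ) :
    ∑ x ∈ (pairs N).filter (fun x ↦ 5 ∣ 3 * x.1 - 4 * x.2 + 1),
      ((x.1 + x.2).negOnePow : ℤ) = 0 := by
  have key : ∀ k l : ℤ, 5 ∣ 3 * k - 4 * l + 1 → ∃ m n, 5 * m = 3 * k - 4 * l + 1 ∧
      5 * n = -4 * k - 3 * l + 2 := fun k l h ↦
    ⟨(3 * k - 4 * l + 1) / 5, (-4 * k - 3 * l + 2) / 5, by omega, by omega⟩
  refine Finset.sum_involution
    (fun x _ ↦ ((3 * x.1 - 4 * x.2 + 1) / 5, (-4 * x.1 - 3 * x.2 + 2) / 5)) ?_ ?_ ?_ ?_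
  · rintro ⟨k, l⟩ hx
    obtain ⟨m, n, hm, hn⟩ := key k l (Finset.mem_filter.mp hx).2
    simp only [← hm, ← hn, Int.mul_ediv_cancel_left _ (by norm_num : (5 : ℤ) ≠ 0)]
    rcases Int.even_or_odd (k + l) with h | h
    · have h' : Odd (m + n) := by grind
      simp [Int.negOnePow_even _ h, Int.negOnePow_odd _ h']
    · have h' : Even (m + n) := by grind
      simp [Int.negOnePow_even _ h', Int.negOnePow_odd _ h]
  · rintro ⟨k, l⟩ hx - h
    obtain ⟨m, n, hm, hn⟩ := key k l (Finset.mem_filter.mp hx).2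
    simp only [Prod.mk.injEq] at h
    omega
  · rintro ⟨k, l⟩ hx
    obtain ⟨m, n, hm, hn⟩ := key k l (Finset.mem_filter.mp hx).2
    simp only [← hm, ← hn, Int.mul_ediv_cancel_left _ (by norm_num : (5 : ℤ) ≠ 0)]
    rw [Finset.mem_filter, mem_pairs] at hx ⊢
    refine ⟨?_, by dsimp only; omega⟩
    have h1 := two_mul_natCast_pentagonal k
    have h2 := two_mul_natCast_pentagonal l
    have h3 := two_mul_natCast_pentagonal m
    have h4 := two_mul_natCast_pentagonal n
    have h5 : (pentagonal m + pentagonal n : ℤ) = pentagonal k + pentagonal l := by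
      have : 50 * (pentagonal m + pentagonal n : ℤ) = 50 * (pentagonal k + pentagonal l) := by
        linear_combination 25 * h3 + 25 * h4 - 25 * h1 - 25 * h2 +
          (15 * m + 3 * (3 * k - 4 * l + 1) - 5) * hm +
          (15 * n + 3 * (-4 * k - 3 * l + 2) - 5) * hn
      omega
    rw [← hx.1]
    exact_mod_cast h5
  · rintro ⟨k, l⟩ hx
    obtain ⟨m, n, hm, hn⟩ := key k l (Finset.mem_filter.mp hx).2
    simp only [Prod.mk.injEq]
    omega

theorem sum_pairs_swap_eq_zero (N : ℕ) :
    ∑ x ∈ (pairs N).filter (fun x ↦ 5 ∣ 3 * x.2 - 4 * x.1 + 1),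
      ((x.1 + x.2).negOnePow : ℤ) = 0 := by
  rw [← sum_pairs_eq_zero N]
  refine Finset.sum_nbij' Prod.swap Prod.swap ?_ ?_ ?_ ?_ ?_
  · simp +contextual [mem_pairs, add_comm]
  · simp +contextual [mem_pairs, add_comm]
  · simp
  · simp
  · simp [add_comm]

theorem part_zero_mul_part_two :
    part 0 (pentagonalSeries ℤ) * part 2 (pentagonalSeries ℤ) =
      -part 1 (pentagonalSeries ℤ) ^ 2 := by
  set E := pentagonalSeries ℤ with hE
  suffices part 0 E * part 2 E + part 1 E * part 1 E + part 2 E * part 0 E +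
      part 1 E * part 1 E = 0 by
    have h2 : (2 : ℤ⟦X⟧) * (part 0 E * part 2 E) = 2 * (-part 1 E ^ 2) := by
      linear_combination this
    have : (2 : ℤ⟦X⟧) ≠ 0 := fun h ↦ by
      have := congrArg constantCoeff h
      rw [map_ofNat, map_zero] at this
      norm_num at this
    exact mul_left_cancel₀ this h2
  ext N
  simp only [map_add, coeff_mul, ← Finset.sum_add_distrib, map_zero]
  let w : ℕ → ℕ → ℤ := fun x y ↦ (if x % 5 = 0 ∧ y % 5 = 2 then 1 else 0) +
    (if x % 5 = 1 ∧ y % 5 = 1 then 1 else 0) + (if x % 5 = 2 ∧ y % 5 = 0 then 1 else 0) +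
    (if x % 5 = 1 ∧ y % 5 = 1 then 1 else 0)
  trans ∑ x ∈ Finset.HasAntidiagonal.antidiagonal N, w x.1 x.2 * (coeff x.1 E * coeff x.2 E)
  · refine Finset.sum_congr rfl fun x _ ↦ ?_
    simp only [part, coeff_mk, w]
    split_ifs <;> omega
  · rw [hE, sum_antidiagonal_pentagonalSeries,
      ← add_zero (0 : ℤ)]
    nth_rewrite 1 [← sum_pairs_eq_zero N]
    rw [← sum_pairs_swap_eq_zero N, Finset.sum_filter, Finset.sum_filter,
      ← Finset.sum_add_distrib]
    refine Finset.sum_congr rfl fun x _ ↦ ?_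
    have h1 : x.1 % 5 = 0 ∨ x.1 % 5 = 1 ∨ x.1 % 5 = 2 ∨ x.1 % 5 = 3 ∨ x.1 % 5 = 4 := by omega
    have h2 : x.2 % 5 = 0 ∨ x.2 % 5 = 1 ∨ x.2 % 5 = 2 ∨ x.2 % 5 = 3 ∨ x.2 % 5 = 4 := by omega
    have h3 : (5 ∣ 3 * x.1 - 4 * x.2 + 1) ↔ (x.2 - 2 * x.1 + 1) % 5 = 0 := by omega
    have h4 : (5 ∣ 3 * x.2 - 4 * x.1 + 1) ↔ (x.1 - 2 * x.2 + 1) % 5 = 0 := by omega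
    simp only [h3, h4, w, pentagonal_mod_five]
    rcases h1 with h1 | h1 | h1 | h1 | h1 <;> rcases h2 with h2 | h2 | h2 | h2 | h2 <;>
      simp [h1, h2, Int.sub_emod, Int.add_emod, Int.mul_emod]
    all_goals ring

theorem part_one_eq :
    part 1 (pentagonalSeries ℤ) = -(X * expand 25 (by norm_num) (pentagonalSeries ℤ)) := by
  have hP : ∀ c : ℤ, pentagonal (1 - 5 * c) = 25 * pentagonal c + 1 := fun c ↦ by
    have h1 := two_mul_natCast_pentagonal c
    have h2 := two_mul_natCast_pentagonal (1 - 5 * c)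
    zify
    linarith
  ext N
  rcases N with _ | N
  · simp [part]
  rw [map_neg, coeff_succ_X_mul]
  simp only [part, coeff_mk]
  by_cases h : N + 1 ∈ Set.range pentagonal
  · obtain ⟨k, hk⟩ := h
    have hm := pentagonal_mod_five k
    rw [hk] at hm
    split_ifs at hm with h1 h2
    · obtain ⟨c, rfl⟩ : ∃ c, k = 1 - 5 * c := ⟨(1 - k) / 5, by omega⟩
      have hN : N = 25 * pentagonal c := by
        have := hP c
        omega
      rw [if_pos hm, ← hk, hN, coeff_expand_mul, coeff_pentagonalSeries_pentagonal,
        coeff_pentagonalSeries_pentagonal, Int.negOnePow_sub]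
      rcases Int.even_or_odd c with h | h
      · have h' : Even (5 * c) := h.mul_left 5
        simp [Int.negOnePow_even _ h, Int.negOnePow_even _ h']
      · have h' : Odd (5 * c) := by grind
        simp [Int.negOnePow_odd _ h, Int.negOnePow_odd _ h']
    all_goals
      rw [if_neg (by omega), coeff_expand_of_not_dvd _ _ _ (by omega), neg_zero]
  · rw [coeff_pentagonalSeries_eq_zero ℤ h, ite_self, eq_comm, neg_eq_zero]
    by_cases hd : 25 ∣ N
    · obtain ⟨M, rfl⟩ := hd
      rw [coeff_expand_mul]
      apply coeff_pentagonalSeries_eq_zero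
      rintro ⟨c, rfl⟩
      exact h ⟨_, hP c⟩
    · exact coeff_expand_of_not_dvd _ _ _ hd

theorem eq_sum_part :
    pentagonalSeries ℤ = part 0 (pentagonalSeries ℤ) + part 1 (pentagonalSeries ℤ) +
      part 2 (pentagonalSeries ℤ) := by
  ext n
  simp only [part, map_add, coeff_mk]
  by_cases h : n ∈ Set.range pentagonal
  · obtain ⟨k, rfl⟩ := h
    have := pentagonal_mod_five k
    split_ifs at this <;> simp [this]
  · simp [coeff_pentagonalSeries_eq_zero ℤ h]

theorem map_pentagonalSeries (R : Type*) [CommRing R] :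
    map (Int.castRingHom R) (pentagonalSeries ℤ) = pentagonalSeries R := by
  ext n
  by_cases h : n ∈ Set.range pentagonal
  · obtain ⟨k, rfl⟩ := h
    simp only [coeff_map, coeff_pentagonalSeries_pentagonal]
    simp
  · simp [coeff_map, coeff_pentagonalSeries_eq_zero _ h]

section Product

variable {R : Type*} [CommRing R]

theorem prod_one_sub_mul_of_sum_eq_zero {s : R} (hs : 1 + s + s ^ 2 + s ^ 3 + s ^ 4 = 0) (Y : R) :
    (1 - Y) * (1 - s * Y) * (1 - s ^ 2 * Y) * (1 - s ^ 3 * Y) * (1 - s ^ 4 * Y) = 1 - Y ^ 5 := by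
  grind

theorem prod_dissection_of_sum_eq_zero {s a b e : R} (hs : 1 + s + s ^ 2 + s ^ 3 + s ^ 4 = 0)
    (h : a * b = -e ^ 2) :
    (a + e + b) * (a + s * e + s ^ 2 * b) * (a + s ^ 2 * e + s ^ 4 * b) *
      (a + s ^ 3 * e + s ^ 6 * b) * (a + s ^ 4 * e + s ^ 8 * b) =
      a ^ 5 + 11 * e ^ 5 + b ^ 5 := by
  grind

/-- The finite product `∏ i < M, (1 - X ^ (i + 1))`. -/
noncomputable def finiteProduct (R : Type*) [CommRing R] (M : ℕ) : R⟦X⟧ :=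
  ∏ i ∈ Finset.range M, (1 - X ^ (i + 1))

theorem finiteProduct_succ (M : ℕ) :
    finiteProduct R (M + 1) = finiteProduct R M * (1 - X ^ (M + 1)) :=
  Finset.prod_range_succ _ _

theorem prod_rescale_one_sub_X_pow {s : R} (hs : 1 + s + s ^ 2 + s ^ 3 + s ^ 4 = 0) {n : ℕ}
    (hn : ¬ 5 ∣ n) :
    ∏ j ∈ Finset.range 5, rescale (s ^ j) (1 - X ^ n : R⟦X⟧) = 1 - X ^ (5 * n) := by
  have h5 : s ^ 5 = 1 := by linear_combination (s - 1) * hs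
  have hsn : 1 + s ^ n + (s ^ n) ^ 2 + (s ^ n) ^ 3 + (s ^ n) ^ 4 = 0 := by
    have hd := Nat.div_add_mod n 5
    have h1 : s ^ n = s ^ (n % 5) := by
      rw [← hd, pow_add, pow_mul, h5, one_pow, one_mul]
      simp
    have h2 : n % 5 = 1 ∨ n % 5 = 2 ∨ n % 5 = 3 ∨ n % 5 = 4 := by omega
    rcases h2 with h | h | h | h <;> rw [h1, h] <;> grind
  have hC : 1 + C (s ^ n) + C (s ^ n) ^ 2 + C (s ^ n) ^ 3 + C (s ^ n) ^ 4 = (0 : R⟦X⟧) := by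
    simpa only [map_add, map_one, map_pow, map_zero] using congrArg (C (R := R)) hsn
  have := prod_one_sub_mul_of_sum_eq_zero hC (X ^ n)
  rw [mul_comm 5 n, pow_mul, ← this]
  simp only [Finset.prod_range_succ, Finset.prod_range_zero, map_sub, map_one, map_pow, rescale_X,
    mul_pow, one_mul, pow_zero]
  ring

theorem prod_rescale_one_sub_X_pow_of_dvd {s : R} (h5 : s ^ 5 = 1) (n : ℕ) :
    ∏ j ∈ Finset.range 5, rescale (s ^ j) (1 - X ^ (5 * n) : R⟦X⟧) = (1 - X ^ (5 * n)) ^ 5 := by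
  have (j : ℕ) : rescale (s ^ j) (1 - X ^ (5 * n) : R⟦X⟧) = 1 - X ^ (5 * n) := by
    rw [map_sub, map_one, map_pow, rescale_X, mul_pow, ← map_pow, ← pow_mul,
      show j * (5 * n) = 5 * (j * n) by ring, pow_mul, h5, one_pow, map_one, one_mul]
  simp [this]

theorem prod_rescale_finiteProduct {s : R} (hs : 1 + s + s ^ 2 + s ^ 3 + s ^ 4 = 0) (M : ℕ) :
    (∏ j ∈ Finset.range 5, rescale (s ^ j) (finiteProduct R (5 * M))) *
        expand 25 (by norm_num) (finiteProduct R M) =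
      expand 5 (by norm_num) (finiteProduct R (5 * M)) *
        expand 5 (by norm_num) (finiteProduct R M) ^ 5 := by
  induction M with
  | zero => simp [finiteProduct]
  | succ M ih =>
    have h5 : s ^ 5 = 1 := by linear_combination (s - 1) * hs
    have e (n : ℕ) : expand 5 (by norm_num) (1 - X ^ n : R⟦X⟧) = 1 - X ^ (5 * n) := by
      simp [pow_mul]
    have e' (n : ℕ) : expand 25 (by norm_num) (1 - X ^ n : R⟦X⟧) = 1 - X ^ (25 * n) := by
      simp [pow_mul]
    have h6 : 5 * (M + 1) = 5 * M + 1 + 1 + 1 + 1 + 1 := by ring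
    have h7 : 5 * M + 1 + 1 + 1 + 1 + 1 = 5 * (M + 1) := by ring
    rw [h6]
    simp only [finiteProduct_succ, map_mul, Finset.prod_mul_distrib]
    rw [prod_rescale_one_sub_X_pow hs (by omega), prod_rescale_one_sub_X_pow hs (by omega),
      prod_rescale_one_sub_X_pow hs (by omega), prod_rescale_one_sub_X_pow hs (by omega), h7,
      prod_rescale_one_sub_X_pow_of_dvd h5]
    simp only [e, e']
    rw [show 5 * (5 * (M + 1)) = 25 * (M + 1) by ring]
    linear_combination (1 - X ^ (5 * (5 * M + 1))) * (1 - X ^ (5 * (5 * M + 1 + 1))) *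
      (1 - X ^ (5 * (5 * M + 1 + 1 + 1))) * (1 - X ^ (5 * (5 * M + 1 + 1 + 1 + 1))) *
      (1 - X ^ (5 * (M + 1))) ^ 5 * (1 - X ^ (25 * (M + 1))) * ih

open scoped PowerSeries.WithPiTopology
open Filter Topology

theorem tendsto_finiteProduct [TopologicalSpace R] :
    Tendsto (finiteProduct R) atTop (𝓝 (pentagonalSeries R)) :=
  (WithPiTopology.hasProd_one_sub_X_pow R).tendsto_prod_nat

theorem continuous_rescale [TopologicalSpace R] [IsTopologicalRing R] (a : R) :
    Continuous (rescale a : R⟦X⟧ → R⟦X⟧) := by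
  rw [continuous_iff_continuousAt]
  intro f
  rw [ContinuousAt, WithPiTopology.tendsto_iff_coeff_tendsto]
  intro d
  simp only [coeff_rescale]
  exact ((WithPiTopology.continuous_coeff R d).tendsto f).const_mul _

theorem continuous_expand [TopologicalSpace R] (p : ℕ) (hp : p ≠ 0) :
    Continuous (expand p hp : R⟦X⟧ → R⟦X⟧) := by
  rw [continuous_iff_continuousAt]
  intro f
  rw [ContinuousAt, WithPiTopology.tendsto_iff_coeff_tendsto]
  intro d
  simp only [coeff_expand]
  split_ifs
  · exact (WithPiTopology.continuous_coeff R _).tendsto f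
  · exact tendsto_const_nhds

theorem prod_rescale_pentagonalSeries {s : R} (hs : 1 + s + s ^ 2 + s ^ 3 + s ^ 4 = 0) :
    (∏ j ∈ Finset.range 5, rescale (s ^ j) (pentagonalSeries R)) *
        expand 25 (by norm_num) (pentagonalSeries R) =
      expand 5 (by norm_num) (pentagonalSeries R) ^ 6 := by
  let _ : TopologicalSpace R := ⊥
  have _ : DiscreteTopology R := ⟨rfl⟩
  have hM : Tendsto (fun M : ℕ ↦ 5 * M) atTop atTop :=
    tendsto_id.const_mul_atTop' (by norm_num)
  have h5 := tendsto_finiteProduct (R := R) |>.comp hM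
  have h1 := tendsto_finiteProduct (R := R)
  have hl := (tendsto_finsetProd (Finset.range 5) fun j _ ↦
    ((continuous_rescale (s ^ j)).tendsto _).comp h5).mul
    (((continuous_expand 25 (by norm_num)).tendsto _).comp h1)
  have hr := (((continuous_expand 5 (by norm_num)).tendsto _).comp h5).mul
    ((((continuous_expand 5 (by norm_num)).tendsto _).comp h1).pow 5)
  rw [pow_succ']
  refine tendsto_nhds_unique (hl.congr fun M ↦ ?_) hr
  exact prod_rescale_finiteProduct hs M

end Product

theorem rescale_map_part {R : Type*} [CommRing R] {s : R} (h5 : s ^ 5 = 1) (i j : ℕ) (f : ℤ⟦X⟧) :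
    rescale (s ^ j) (map (Int.castRingHom R) (part i f)) =
      C s ^ (j * i) * map (Int.castRingHom R) (part i f) := by
  ext n
  rw [← map_pow, coeff_rescale, coeff_C_mul, coeff_map]
  simp only [part, coeff_mk]
  split_ifs with h
  · congr 1
    rw [← pow_mul, ← Nat.div_add_mod n 5, h,
      show j * (5 * (n / 5) + i) = 5 * (j * (n / 5)) + j * i by
      ring, pow_add, pow_mul, h5, one_pow, one_mul]
  · simp

theorem dissection_mul_expand :
    (part 0 (pentagonalSeries ℤ) ^ 5 + 11 * part 1 (pentagonalSeries ℤ) ^ 5 +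
        part 2 (pentagonalSeries ℤ) ^ 5) * expand 25 (by norm_num) (pentagonalSeries ℤ) =
      expand 5 (by norm_num) (pentagonalSeries ℤ) ^ 6 := by
  have hinj : Function.Injective (map (Int.castRingHom ℂ)) :=
    PowerSeries.map_injective _ Int.cast_injective
  apply hinj
  have hprim := Complex.isPrimitiveRoot_exp 5 (by norm_num)
  set s := Complex.exp (2 * Real.pi * Complex.I / (5 : ℕ)) with hs_def
  have h5 : s ^ 5 = 1 := hprim.pow_eq_one
  have hs : 1 + s + s ^ 2 + s ^ 3 + s ^ 4 = 0 := by
    have := hprim.geom_sum_eq_zero (by norm_num)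
    simpa [Finset.sum_range_succ] using this
  have hC : 1 + C s + C s ^ 2 + C s ^ 3 + C s ^ 4 = (0 : ℂ⟦X⟧) := by
    simpa only [map_add, map_one, map_pow, map_zero] using congrArg (C (R := ℂ)) hs
  have h := congrArg (map (Int.castRingHom ℂ)) part_zero_mul_part_two
  rw [map_mul, map_neg, map_pow] at h
  have h2 := prod_rescale_pentagonalSeries hs
  rw [← map_pentagonalSeries] at h2
  simp only [map_mul, map_add, map_pow, map_expand, map_ofNat]
  rw [← h2, ← prod_dissection_of_sum_eq_zero hC h]
  congr 1
  conv_rhs => rw [eq_sum_part]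
  simp only [map_add, rescale_map_part h5, Finset.prod_range_succ, Finset.prod_range_zero]
  ring

section Partition

open scoped PowerSeries.WithPiTopology

theorem mk_card_restricted_dvd_mul_expand (l : ℕ) (hl : l ≠ 0) :
    (mk fun n ↦ ((Nat.Partition.restricted n (l ∣ ·)).card : ℤ)) *
      expand l hl (pentagonalSeries ℤ) = 1 := by
  have h1 := Nat.Partition.hasProd_powerSeriesMk_card_restricted ℤ (l ∣ ·)
  have h2 : HasProd (fun i ↦ if l ∣ i + 1 then (1 - X ^ (i + 1) : ℤ⟦X⟧) else 1)
      (expand l hl (pentagonalSeries ℤ)) := by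
    have hinj : Function.Injective fun i ↦ l * (i + 1) - 1 := fun a b hab ↦ by
      have ha : 0 < l * (a + 1) := by positivity
      have hb : 0 < l * (b + 1) := by positivity
      have : l * (a + 1) = l * (b + 1) := by dsimp only at hab; omega
      simpa [hl] using this
    rw [← hinj.hasProd_iff]
    · have h3 := (WithPiTopology.hasProd_one_sub_X_pow ℤ).map (expand l hl : ℤ⟦X⟧ →ₐ[ℤ] ℤ⟦X⟧)
        (continuous_expand l hl)
      convert h3 using 1
      ext1 i
      have ha : 0 < l * (i + 1) := by positivity
      have h4 : l * (i + 1) - 1 + 1 = l * (i + 1) := by omega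
      simp [h4, pow_mul]
    · intro x hx
      rw [if_neg]
      rintro ⟨c, hc⟩
      rcases c with _ | c
      · simp at hc
      · exact hx ⟨c, by dsimp only; omega⟩
  refine (h1.mul h2).unique ?_
  convert! hasProd_one (α := ℤ⟦X⟧) (β := ℕ) using 2 with i
  split_ifs
  · simp_rw [pow_mul]
    exact WithPiTopology.tsum_pow_mul_one_sub_of_constantCoeff_eq_zero (by simp)
  · rw [one_mul]

end Partition

/-- The generating function of the partition numbers. -/
noncomputable def partitionSeries : ℤ⟦X⟧ :=
  mk fun n ↦ (Fintype.card (Nat.Partition n) : ℤ)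

theorem partitionSeries_mul : partitionSeries * pentagonalSeries ℤ = 1 := by
  rw [← mk_card_restricted_dvd_mul_expand 1 one_ne_zero, expand_one_apply]
  congr 1
  ext n
  simp [partitionSeries, Nat.Partition.restricted]

theorem natCast_p1 (l : ℕ) (hl : l ≠ 0) (n : ℕ) :
    (p1 l n : ℤ) = coeff n (partitionSeries * expand l hl partitionSeries) := by
  have h : expand l hl partitionSeries =
      mk fun n ↦ ((Nat.Partition.restricted n (l ∣ ·)).card : ℤ) := by
    have h1 := mk_card_restricted_dvd_mul_expand l hl
    have h2 := congrArg (expand l hl) partitionSeries_mul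
    rw [map_mul, map_one] at h2
    rw [← mul_one (expand l hl partitionSeries), ← h1]
    linear_combination (mk fun n ↦ ((Nat.Partition.restricted n (l ∣ ·)).card : ℤ)) * h2
  rw [h, coeff_mul, Finset.Nat.sum_antidiagonal_eq_sum_range_succ_mk, p1]
  push_cast
  refine Finset.sum_congr rfl fun a _ ↦ ?_
  rw [partitionSeries, coeff_mk, coeff_mk, Nat.Partition.restricted, Fintype.card_subtype]

/-- The power series `f` is supported on exponents in the residue class `r` modulo `5`. -/
def IsClass (r : ZMod 5) (f : ℤ⟦X⟧) : Prop :=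
  ∀ n : ℕ, (n : ZMod 5) ≠ r → coeff n f = 0

namespace IsClass

theorem mul {r s : ZMod 5} {f g : ℤ⟦X⟧} (hf : IsClass r f) (hg : IsClass s g) :
    IsClass (r + s) (f * g) := by
  intro n hn
  rw [coeff_mul]
  refine Finset.sum_eq_zero fun x hx ↦ ?_
  by_cases h1 : (x.1 : ZMod 5) = r
  · have h2 : (x.2 : ZMod 5) ≠ s := by
      rintro rfl
      rw [Finset.HasAntidiagonal.mem_antidiagonal] at hx
      exact hn (by rw [← hx, ← h1]; push_cast; rfl)
    rw [hg _ h2, mul_zero]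
  · rw [hf _ h1, zero_mul]

theorem pow {r : ZMod 5} {f : ℤ⟦X⟧} (hf : IsClass r f) (k : ℕ) : IsClass (k * r) (f ^ k) := by
  induction k with
  | zero =>
    intro n hn
    have : n ≠ 0 := by rintro rfl; simp at hn
    rw [pow_zero, coeff_one, if_neg this]
  | succ k ih =>
    rw [pow_succ, Nat.cast_succ, add_mul, one_mul]
    exact ih.mul hf

theorem part (i : ℕ) (f : ℤ⟦X⟧) : IsClass i (part i f) := by
  intro n hn
  rw [EulerSeries.part, coeff_mk, if_neg]
  rintro rfl
  simp at hn

theorem expand (f : ℤ⟦X⟧) : IsClass 0 (expand 5 (by norm_num) f) := by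
  intro n hn
  refine coeff_expand_of_not_dvd _ _ _ fun h ↦ hn ?_
  exact (ZMod.natCast_eq_zero_iff n 5).mpr h

end IsClass

/-- The operator `∑ a(n) X ^ n ↦ ∑ a(5 n) X ^ n`. -/
noncomputable def atkinU : ℤ⟦X⟧ →ₗ[ℤ] ℤ⟦X⟧ where
  toFun f := mk fun n ↦ coeff (5 * n) f
  map_add' f g := by ext; simp
  map_smul' c f := by ext n; simp only [coeff_mk, LinearMap.map_smul_of_tower, RingHom.id_apply]

@[simp]
theorem coeff_atkinU (f : ℤ⟦X⟧) (n : ℕ) : coeff n (atkinU f) = coeff (5 * n) f :=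
  coeff_mk n fun n ↦ coeff (5 * n) f

theorem atkinU_expand_mul (f g : ℤ⟦X⟧) :
    atkinU (expand 5 (by norm_num) f * g) = f * atkinU g := by
  ext n
  rw [coeff_atkinU, coeff_mul, coeff_mul]
  symm
  refine Finset.sum_of_injOn (fun x ↦ (5 * x.1, 5 * x.2)) ?_ ?_ ?_ ?_
  · rintro ⟨a, b⟩ - ⟨c, d⟩ - h
    simpa using h
  · rintro ⟨a, b⟩ hx
    simp only [Finset.mem_coe, Finset.HasAntidiagonal.mem_antidiagonal] at hx ⊢
    omega
  · rintro ⟨a, b⟩ hx hxy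
    by_cases h : 5 ∣ a
    · obtain ⟨c, rfl⟩ := h
      rw [Finset.HasAntidiagonal.mem_antidiagonal] at hx
      refine absurd ⟨(c, n - c), ?_, ?_⟩ hxy
      · simp only [Finset.mem_coe, Finset.HasAntidiagonal.mem_antidiagonal]
        omega
      · simp only [Prod.mk.injEq, true_and]
        omega
    · rw [coeff_expand_of_not_dvd _ _ _ h, zero_mul]
  · rintro ⟨a, b⟩ -
    simp [coeff_expand_mul]

theorem atkinU_expand (f : ℤ⟦X⟧) : atkinU (expand 5 (by norm_num) f) = f := by
  ext n
  simp [coeff_expand_mul]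

theorem IsClass.atkinU_eq_zero {r : ZMod 5} {f : ℤ⟦X⟧} (hf : IsClass r f) (hr : r ≠ 0) :
    atkinU f = 0 := by
  ext n
  rw [coeff_atkinU, map_zero]
  refine hf _ ?_
  have h5 : (5 : ZMod 5) = 0 := rfl
  rw [Nat.cast_mul, Nat.cast_ofNat, h5, zero_mul]
  exact hr.symm

/-- The series `X * E(X ^ 25)`, where `E` is Euler's series. -/
noncomputable def shifted : ℤ⟦X⟧ := X * expand 25 (by norm_num) (pentagonalSeries ℤ)

/-- The quotient `X * E(X ^ 25) / E(X)`. -/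
noncomputable def etaQuot : ℤ⟦X⟧ := shifted * partitionSeries

/-- The Hauptmodul `X * E(X ^ 5) ^ 6 / E(X) ^ 6`. -/
noncomputable def hauptmodul : ℤ⟦X⟧ :=
  X * expand 5 (by norm_num) (pentagonalSeries ℤ) ^ 6 * partitionSeries ^ 6

theorem expand_twentyFive (f : ℤ⟦X⟧) :
    expand 25 (by norm_num) f = expand 5 (by norm_num) (expand 5 (by norm_num) f) :=
  expand_mul 5 (by norm_num) 5 (by norm_num) f

theorem expand_partitionSeries_mul :
    expand 5 (by norm_num) partitionSeries * expand 5 (by norm_num) (pentagonalSeries ℤ) = 1 := by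
  rw [← map_mul, partitionSeries_mul, map_one]

theorem etaQuot_pow_six : etaQuot ^ 6 = expand 5 (by norm_num) hauptmodul * hauptmodul := by
  have h : (expand 5 (by norm_num) partitionSeries *
      expand 5 (by norm_num) (pentagonalSeries ℤ)) ^ 6 = 1 := by
    rw [expand_partitionSeries_mul, one_pow]
  simp only [etaQuot, shifted, hauptmodul, map_mul, map_pow, expand_X, expand_twentyFive]
  linear_combination -(X ^ 6 * expand 5 (by norm_num) (expand 5 (by norm_num)
    (pentagonalSeries ℤ)) ^ 6 * partitionSeries ^ 6) * h

theorem shifted_pow_five :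
    shifted ^ 5 = expand 5 (by norm_num)
      (X * expand 5 (by norm_num) (pentagonalSeries ℤ) ^ 5) := by
  simp only [shifted, map_mul, map_pow, expand_X, expand_twentyFive]
  ring

theorem modular_equation :
    pentagonalSeries ℤ ^ 5 + 5 * pentagonalSeries ℤ ^ 4 * shifted +
      15 * pentagonalSeries ℤ ^ 3 * shifted ^ 2 + 25 * pentagonalSeries ℤ ^ 2 * shifted ^ 3 +
      25 * pentagonalSeries ℤ * shifted ^ 4 =
    expand 5 (by norm_num) (pentagonalSeries ℤ ^ 6 * expand 5 (by norm_num) partitionSeries) := by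
  have h0 := part_zero_mul_part_two
  have h1 := dissection_mul_expand
  have hE := eq_sum_part
  have h2 : expand 25 (by norm_num) partitionSeries *
      expand 25 (by norm_num) (pentagonalSeries ℤ) = 1 := by
    rw [← map_mul, partitionSeries_mul, map_one]
  rw [part_one_eq, ← shifted] at h0 h1 hE
  rw [map_mul, map_pow, ← expand_twentyFive, ← h1]
  generalize expand 25 _ partitionSeries = p at *
  generalize expand 25 _ (pentagonalSeries ℤ) = q at *
  generalize part 0 (pentagonalSeries ℤ) = a at *
  generalize part 2 (pentagonalSeries ℤ) = b at *
  generalize pentagonalSeries ℤ = E at *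
  generalize shifted = e at *
  subst hE
  linear_combination (5 * a ^ 3 + 10 * a ^ 2 * b + 10 * a * b ^ 2 + 5 * a * e ^ 2 + 5 * b ^ 3 +
    5 * b * e ^ 2) * h0 - (a ^ 5 + 11 * (-e) ^ 5 + b ^ 5) * h2

theorem isClass_shifted : IsClass 1 shifted := by
  have h := IsClass.part 1 (pentagonalSeries ℤ)
  rw [part_one_eq] at h
  intro n hn
  simpa [shifted] using h n (by simpa using hn)

theorem atkinU_monomial (a b c : ℕ) (h : (b + 2 * c : ZMod 5) ≠ 0) :
    atkinU (part 0 (pentagonalSeries ℤ) ^ a * shifted ^ b * part 2 (pentagonalSeries ℤ) ^ c) =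
      0 := by
  have h1 := (((IsClass.part 0 (pentagonalSeries ℤ)).pow a).mul (isClass_shifted.pow b)).mul
    ((IsClass.part 2 (pentagonalSeries ℤ)).pow c)
  refine h1.atkinU_eq_zero ?_
  convert h using 1
  push_cast
  ring

theorem atkinU_shifted_pow_mul (a b : ℕ) (c : ℤ) (L : List (ℤ × ℕ × ℕ × ℕ))
    (hL : ∀ x ∈ L, (x.2.2.1 + 2 * x.2.2.2 : ZMod 5) ≠ 0)
    (h : shifted ^ a * pentagonalSeries ℤ ^ b = c • shifted ^ 5 + (L.map fun x ↦ x.1 •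
      (part 0 (pentagonalSeries ℤ) ^ x.2.1 * shifted ^ x.2.2.1 *
        part 2 (pentagonalSeries ℤ) ^ x.2.2.2)).sum) :
    atkinU (shifted ^ a * pentagonalSeries ℤ ^ b) = c • atkinU (shifted ^ 5) := by
  rw [h, map_add, map_smul, add_eq_left, map_list_sum, List.map_map]
  refine List.sum_eq_zero fun y hy ↦ ?_
  obtain ⟨x, hx, rfl⟩ := List.mem_map.mp hy
  rw [Function.comp_apply, map_smul, atkinU_monomial _ _ _ (hL x hx), smul_zero]

theorem part_zero_mul_part_two_eq_shifted :
    part 0 (pentagonalSeries ℤ) * part 2 (pentagonalSeries ℤ) = -shifted ^ 2 := by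
  rw [part_zero_mul_part_two, part_one_eq, ← shifted, neg_sq]

theorem eq_sum_part_shifted :
    pentagonalSeries ℤ =
      part 0 (pentagonalSeries ℤ) - shifted + part 2 (pentagonalSeries ℤ) := by
  conv_lhs => rw [eq_sum_part, part_one_eq, ← shifted, ← sub_eq_add_neg]

theorem atkinU_shifted_four :
    atkinU (shifted ^ 4 * pentagonalSeries ℤ) = (-1 : ℤ) • atkinU (shifted ^ 5) := by
  rw [← pow_one (pentagonalSeries ℤ)]
  refine atkinU_shifted_pow_mul 4 1 (-1) [(1, 1, 4, 0), (1, 0, 4, 1)] (by decide) ?_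
  have h0 := part_zero_mul_part_two_eq_shifted
  simp only [List.map_cons, List.map_nil, List.sum_cons, List.sum_nil, zsmul_eq_mul]
  push_cast
  conv_lhs => rw [eq_sum_part_shifted]
  ring

theorem atkinU_shifted_three :
    atkinU (shifted ^ 3 * pentagonalSeries ℤ ^ 2) = (-1 : ℤ) • atkinU (shifted ^ 5) := by
  refine atkinU_shifted_pow_mul 3 2 (-1)
    [(1, 2, 3, 0), (1, 0, 3, 2), (-2, 1, 4, 0), (-2, 0, 4, 1)] (by decide) ?_
  have h0 := part_zero_mul_part_two_eq_shifted
  simp only [List.map_cons, List.map_nil, List.sum_cons, List.sum_nil, zsmul_eq_mul]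
  push_cast
  conv_lhs => rw [eq_sum_part_shifted]
  linear_combination 2 * shifted ^ 3 * h0

theorem atkinU_shifted_two :
    atkinU (shifted ^ 2 * pentagonalSeries ℤ ^ 3) = (5 : ℤ) • atkinU (shifted ^ 5) := by
  refine atkinU_shifted_pow_mul 2 3 5
    [(1, 3, 2, 0), (1, 0, 2, 3), (-3, 2, 3, 0), (-3, 0, 3, 2)] (by decide) ?_
  have h0 := part_zero_mul_part_two_eq_shifted
  simp only [List.map_cons, List.map_nil, List.sum_cons, List.sum_nil, zsmul_eq_mul]
  push_cast
  conv_lhs => rw [eq_sum_part_shifted]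
  linear_combination shifted ^ 2 * (3 * part 0 (pentagonalSeries ℤ) +
    3 * part 2 (pentagonalSeries ℤ) - 6 * shifted) * h0

theorem atkinU_shifted_one :
    atkinU (shifted * pentagonalSeries ℤ ^ 4) = (-5 : ℤ) • atkinU (shifted ^ 5) := by
  conv_lhs => rw [← pow_one shifted]
  refine atkinU_shifted_pow_mul 1 4 (-5) [(1, 4, 1, 0), (1, 0, 1, 4), (-4, 3, 2, 0),
    (-4, 0, 2, 3), (2, 2, 3, 0), (2, 0, 3, 2), (8, 1, 4, 0), (8, 0, 4, 1)] (by decide) ?_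
  have h0 := part_zero_mul_part_two_eq_shifted
  simp only [List.map_cons, List.map_nil, List.sum_cons, List.sum_nil, zsmul_eq_mul]
  push_cast
  have hE := eq_sum_part_shifted
  generalize part 0 (pentagonalSeries ℤ) = a at *
  generalize part 2 (pentagonalSeries ℤ) = b at *
  generalize pentagonalSeries ℤ = E at *
  generalize shifted = e at *
  subst hE
  linear_combination (4 * a ^ 2 * e + 6 * a * b * e - 12 * a * e ^ 2 + 4 * b ^ 2 * e -
    12 * b * e ^ 2 + 6 * e ^ 3) * h0

/-- The images of the powers of `etaQuot` under `atkinU`. -/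
noncomputable def trace (i : ℕ) : ℤ⟦X⟧ := atkinU (etaQuot ^ i)

theorem hauptmodul_mul :
    hauptmodul * (pentagonalSeries ℤ ^ 6 * expand 5 (by norm_num) partitionSeries) =
      X * expand 5 (by norm_num) (pentagonalSeries ℤ) ^ 5 := by
  have h : (partitionSeries * pentagonalSeries ℤ) ^ 6 = 1 := by
    rw [partitionSeries_mul, one_pow]
  have h' := expand_partitionSeries_mul
  rw [hauptmodul]
  linear_combination X * expand 5 (by norm_num) (pentagonalSeries ℤ) ^ 5 * (h +
    (partitionSeries * pentagonalSeries ℤ) ^ 6 * h')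

theorem atkinU_shifted_pow_five_mul (f : ℤ⟦X⟧) :
    atkinU (shifted ^ 5 * f) =
      X * expand 5 (by norm_num) (pentagonalSeries ℤ) ^ 5 * atkinU f := by
  rw [shifted_pow_five, atkinU_expand_mul]

theorem atkinU_eq_of_modular {f g : ℤ⟦X⟧}
    (h : expand 5 (by norm_num) (pentagonalSeries ℤ ^ 6 * expand 5 (by norm_num) partitionSeries) *
      f = g) {u : ℤ⟦X⟧}
    (hg : atkinU g = X * expand 5 (by norm_num) (pentagonalSeries ℤ) ^ 5 * u) :
    atkinU f = hauptmodul * u := by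
  have h1 : pentagonalSeries ℤ ^ 6 * expand 5 (by norm_num) partitionSeries * atkinU f =
      X * expand 5 (by norm_num) (pentagonalSeries ℤ) ^ 5 * u := by
    rw [← hg, ← h, atkinU_expand_mul]
  have h2 : (X * expand 5 (by norm_num) (pentagonalSeries ℤ) ^ 5 : ℤ⟦X⟧) ≠ 0 := by
    refine mul_ne_zero X_ne_zero (pow_ne_zero _ fun h ↦ ?_)
    have := expand_partitionSeries_mul
    rw [h, mul_zero] at this
    exact zero_ne_one this
  refine mul_left_cancel₀ h2 ?_
  linear_combination hauptmodul * h1 - atkinU f * hauptmodul_mul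

theorem etaQuot_mul : etaQuot * pentagonalSeries ℤ = shifted := by
  rw [etaQuot, mul_assoc, partitionSeries_mul, mul_one]

theorem atkinU_one : atkinU 1 = 1 := by
  rw [← map_one (expand 5 (by norm_num) : ℤ⟦X⟧ →ₐ[ℤ] ℤ⟦X⟧), atkinU_expand, map_one]

theorem trace_zero : trace 0 = 1 := by
  rw [trace, pow_zero, atkinU_one]

theorem atkinU_ofNat_mul (n : ℕ) [n.AtLeastTwo] (f : ℤ⟦X⟧) :
    atkinU (ofNat(n) * f) = ofNat(n) * atkinU f := by
  have h (g : ℤ⟦X⟧) : ofNat(n) * g = (OfNat.ofNat n : ℕ) • g := by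
    rw [nsmul_eq_mul, Nat.cast_ofNat]
  rw [h, h, map_nsmul]

theorem trace_add_five (i : ℕ) : trace (i + 5) = hauptmodul *
    (25 * trace (i + 4) + 25 * trace (i + 3) + 15 * trace (i + 2) + 5 * trace (i + 1) +
      trace i) := by
  refine atkinU_eq_of_modular (g := shifted ^ 5 * (25 * etaQuot ^ (i + 4) +
    25 * etaQuot ^ (i + 3) + 15 * etaQuot ^ (i + 2) + 5 * etaQuot ^ (i + 1) + etaQuot ^ i)) ?_ ?_
  · rw [← modular_equation, ← etaQuot_mul]
    ring
  · rw [atkinU_shifted_pow_five_mul]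
    simp only [map_add, atkinU_ofNat_mul, trace]

theorem atkinU_shifted_pow_five :
    atkinU (shifted ^ 5) = X * expand 5 (by norm_num) (pentagonalSeries ℤ) ^ 5 := by
  rw [← mul_one (shifted ^ 5), atkinU_shifted_pow_five_mul, atkinU_one, mul_one]

theorem trace_one : trace 1 = 5 * hauptmodul := by
  rw [trace, mul_comm]
  refine atkinU_eq_of_modular (g := 25 * shifted ^ 5 + 25 * (shifted ^ 4 * pentagonalSeries ℤ) +
    15 * (shifted ^ 3 * pentagonalSeries ℤ ^ 2) + 5 * (shifted ^ 2 * pentagonalSeries ℤ ^ 3) +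
    shifted * pentagonalSeries ℤ ^ 4) ?_ ?_
  · rw [← modular_equation, ← etaQuot_mul]
    ring
  · simp only [map_add, atkinU_ofNat_mul, atkinU_shifted_four, atkinU_shifted_three,
      atkinU_shifted_two, atkinU_shifted_one, atkinU_shifted_pow_five, zsmul_eq_mul]
    push_cast
    ring

theorem trace_two : trace 2 = hauptmodul * (25 * trace 1 + 10) := by
  refine atkinU_eq_of_modular (g := 25 * (shifted ^ 5 * etaQuot ^ 1) + 25 * shifted ^ 5 +
    15 * (shifted ^ 4 * pentagonalSeries ℤ) +
    5 * (shifted ^ 3 * pentagonalSeries ℤ ^ 2) + shifted ^ 2 * pentagonalSeries ℤ ^ 3) ?_ ?_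
  · rw [← modular_equation, ← etaQuot_mul]
    ring
  · simp only [map_add, atkinU_ofNat_mul, atkinU_shifted_pow_five_mul, atkinU_shifted_four,
      atkinU_shifted_three, atkinU_shifted_two, atkinU_shifted_pow_five, zsmul_eq_mul, trace]
    push_cast
    ring

theorem trace_three : trace 3 = hauptmodul * (25 * trace 2 + 25 * trace 1 + 9) := by
  refine atkinU_eq_of_modular (g := 25 * (shifted ^ 5 * etaQuot ^ 2) +
    25 * (shifted ^ 5 * etaQuot ^ 1) + 15 * shifted ^ 5 +
    5 * (shifted ^ 4 * pentagonalSeries ℤ) + shifted ^ 3 * pentagonalSeries ℤ ^ 2) ?_ ?_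
  · rw [← modular_equation, ← etaQuot_mul]
    ring
  · simp only [map_add, atkinU_ofNat_mul, atkinU_shifted_pow_five_mul, atkinU_shifted_four,
      atkinU_shifted_three, atkinU_shifted_pow_five, zsmul_eq_mul, trace]
    push_cast
    ring

theorem trace_four :
    trace 4 = hauptmodul * (25 * trace 3 + 25 * trace 2 + 15 * trace 1 + 4) := by
  refine atkinU_eq_of_modular (g := 25 * (shifted ^ 5 * etaQuot ^ 3) +
    25 * (shifted ^ 5 * etaQuot ^ 2) + 15 * (shifted ^ 5 * etaQuot ^ 1) + 5 * shifted ^ 5 +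
    shifted ^ 4 * pentagonalSeries ℤ) ?_ ?_
  · rw [← modular_equation, ← etaQuot_mul]
    ring
  · simp only [map_add, atkinU_ofNat_mul, atkinU_shifted_pow_five_mul, atkinU_shifted_four,
      atkinU_shifted_pow_five, zsmul_eq_mul, trace]
    push_cast
    ring

/-- The `ℤ`-module of polynomials in the Hauptmodul without terms of degree below `i / 5`, in
which the coefficient of degree `l` is divisible by `5 ^ ((5 * l - i - 1) / 2)`. -/
noncomputable def traceModule (i : ℕ) : Submodule ℤ ℤ⟦X⟧ :=
  Submodule.span ℤ {f | ∃ l, i ≤ 5 * l ∧ f = 5 ^ ((5 * l - i - 1) / 2) * hauptmodul ^ l}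

theorem mul_mem_of_dvd {S : Submodule ℤ ℤ⟦X⟧} {a b : ℕ} {g : ℤ⟦X⟧} (hab : a ≤ b)
    (h : 5 ^ a * g ∈ S) : 5 ^ b * g ∈ S := by
  obtain ⟨c, rfl⟩ := Nat.exists_eq_add_of_le hab
  have : (5 ^ (a + c) * g : ℤ⟦X⟧) = (5 ^ c : ℤ) • (5 ^ a * g) := by
    rw [zsmul_eq_mul]
    push_cast
    ring
  rw [this]
  exact S.smul_mem _ h

theorem pow_mul_hauptmodul_pow_mem {i l e : ℕ} (h : i ≤ 5 * l) (he : (5 * l - i - 1) / 2 ≤ e) :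
    5 ^ e * hauptmodul ^ l ∈ traceModule i :=
  mul_mem_of_dvd he (Submodule.subset_span ⟨l, h, rfl⟩)

/-- Multiplication by a fixed power series maps a span into a submodule as soon as it does so
on generators. -/
theorem mul_mem_of_mem_span {A : Set ℤ⟦X⟧} {S : Submodule ℤ ℤ⟦X⟧} {c f : ℤ⟦X⟧}
    (hf : f ∈ Submodule.span ℤ A) (h : ∀ g ∈ A, c * g ∈ S) : c * f ∈ S := by
  have h1 : Submodule.span ℤ A ≤ S.comap (LinearMap.mulLeft ℤ c) :=
    Submodule.span_le.mpr fun g hg ↦ h g hg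
  exact h1 hf

theorem pow_mul_hauptmodul_mul_mem {i j e : ℕ} {f : ℤ⟦X⟧} (hf : f ∈ traceModule i)
    (hj : j ≤ i + 5) (he : (i + 5) ≤ j + 2 * e) :
    5 ^ e * hauptmodul * f ∈ traceModule j := by
  refine mul_mem_of_mem_span hf ?_
  rintro _ ⟨l, hl, rfl⟩
  have := pow_mul_hauptmodul_pow_mem (i := j) (l := l + 1) (e := e + (5 * l - i - 1) / 2)
    (by omega) (by omega)
  convert this using 1
  ring

theorem trace_mem (i : ℕ) : trace i ∈ traceModule i := by
  have ofPow (i e : ℕ) (c : ℤ) (hi : i ≤ 5) (he : (4 - i) / 2 ≤ e) :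
      c • (5 ^ e * hauptmodul) ∈ traceModule i := by
    have := pow_mul_hauptmodul_pow_mem (i := i) (l := 1) (e := e) (by omega) (by omega)
    rw [pow_one] at this
    exact Submodule.smul_mem _ c this
  induction i using Nat.strong_induction_on with
  | _ i ih =>
    match i, ih with
    | 0, _ =>
      rw [trace_zero]
      simpa using pow_mul_hauptmodul_pow_mem (i := 0) (l := 0) (e := 0) le_rfl (by omega)
    | 1, _ =>
      rw [trace_one]
      simpa using ofPow 1 1 1 (by omega) (by omega)
    | 2, ih =>
      have h1 := pow_mul_hauptmodul_mul_mem (e := 2) (j := 2) (ih 1 (by omega))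
        (by omega) (by omega)
      convert add_mem h1 (ofPow 2 1 2 (by omega) (by omega)) using 1
      rw [trace_two, zsmul_eq_mul]
      push_cast
      ring
    | 3, ih =>
      have h1 := pow_mul_hauptmodul_mul_mem (e := 2) (j := 3) (ih 2 (by omega))
        (by omega) (by omega)
      have h2 := pow_mul_hauptmodul_mul_mem (e := 2) (j := 3) (ih 1 (by omega))
        (by omega) (by omega)
      convert add_mem (add_mem h1 h2) (ofPow 3 0 9 (by omega) (by omega)) using 1
      rw [trace_three, zsmul_eq_mul]
      push_cast
      ring
    | 4, ih =>
      have h1 := pow_mul_hauptmodul_mul_mem (e := 2) (j := 4) (ih 3 (by omega))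
        (by omega) (by omega)
      have h2 := pow_mul_hauptmodul_mul_mem (e := 2) (j := 4) (ih 2 (by omega))
        (by omega) (by omega)
      have h3 := pow_mul_hauptmodul_mul_mem (e := 1) (j := 4) (ih 1 (by omega))
        (by omega) (by omega)
      convert add_mem (add_mem (add_mem h1 h2) (Submodule.smul_mem _ (3 : ℤ) h3))
        (ofPow 4 0 4 (by omega) (by omega)) using 1
      rw [trace_four, zsmul_eq_mul, zsmul_eq_mul]
      push_cast
      ring
    | i + 5, ih =>
      have h1 := pow_mul_hauptmodul_mul_mem (e := 2) (j := i + 5) (ih (i + 4) (by omega))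
        (by omega) (by omega)
      have h2 := pow_mul_hauptmodul_mul_mem (e := 2) (j := i + 5) (ih (i + 3) (by omega))
        (by omega) (by omega)
      have h3 := pow_mul_hauptmodul_mul_mem (e := 1) (j := i + 5) (ih (i + 2) (by omega))
        (by omega) (by omega)
      have h4 := pow_mul_hauptmodul_mul_mem (e := 1) (j := i + 5) (ih (i + 1) (by omega))
        (by omega) (by omega)
      have h5 := pow_mul_hauptmodul_mul_mem (e := 0) (j := i + 5) (ih i (by omega))
        (by omega) (by omega)
      convert add_mem (add_mem (add_mem (add_mem h1 h2) (Submodule.smul_mem _ (3 : ℤ) h3)) h4) h5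
        using 1
      rw [trace_add_five, zsmul_eq_mul]
      push_cast
      ring

/-- The `ℤ`-module of polynomials in the Hauptmodul without constant term, in which the
coefficient of degree `j` is divisible by `5 ^ (a + (5 * j - 5) / 2)`. -/
noncomputable def divModule (a : ℕ) : Submodule ℤ ℤ⟦X⟧ :=
  Submodule.span ℤ {f | ∃ j, 1 ≤ j ∧ f = 5 ^ (a + (5 * j - 5) / 2) * hauptmodul ^ j}

theorem hauptmodul_ne_zero : hauptmodul ≠ 0 := by
  intro h
  have h1 : hauptmodul * (pentagonalSeries ℤ ^ 6 *
      expand 5 (by norm_num) partitionSeries ^ 6) = X := by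
    have h2 := congrArg (· ^ 6) partitionSeries_mul
    have h3 := congrArg (· ^ 6) expand_partitionSeries_mul
    simp only [one_pow, mul_pow] at h2 h3
    rw [hauptmodul]
    linear_combination X * h2 + X * partitionSeries ^ 6 * pentagonalSeries ℤ ^ 6 * h3
  rw [h, zero_mul] at h1
  exact X_ne_zero h1.symm

theorem traceModule_cancel {i j : ℕ} {f : ℤ⟦X⟧}
    (hf : hauptmodul ^ j * f ∈ traceModule (i + 5 * j)) : f ∈ traceModule i := by
  have h : traceModule (i + 5 * j) ≤
      (traceModule i).map (LinearMap.mulLeft ℤ (hauptmodul ^ j)) := by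
    refine Submodule.span_le.mpr ?_
    rintro _ ⟨l, hl, rfl⟩
    obtain ⟨m, rfl⟩ := Nat.exists_eq_add_of_le (show j ≤ l by omega)
    refine ⟨5 ^ ((5 * m - i - 1) / 2) * hauptmodul ^ m,
      pow_mul_hauptmodul_pow_mem (by omega) le_rfl, ?_⟩
    rw [LinearMap.mulLeft_apply, show 5 * (j + m) - (i + 5 * j) - 1 = 5 * m - i - 1 by omega]
    ring
  obtain ⟨g, hg, hgf⟩ := h hf
  rwa [← mul_left_cancel₀ (pow_ne_zero j hauptmodul_ne_zero) hgf]

theorem atkinU_hauptmodul_pow_mul_mem (j s : ℕ) :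
    atkinU (hauptmodul ^ j * etaQuot ^ s) ∈ traceModule (j + s) := by
  refine traceModule_cancel (j := j) ?_
  have h : hauptmodul ^ j * atkinU (hauptmodul ^ j * etaQuot ^ s) = trace (6 * j + s) := by
    rw [← atkinU_expand_mul, trace, pow_add, pow_mul, etaQuot_pow_six, map_pow]
    ring_nf
  rw [h, show j + s + 5 * j = 6 * j + s by ring]
  exact trace_mem _

theorem atkinU_mul_etaQuot_mem {a s : ℕ} {f : ℤ⟦X⟧} (hs : s ≤ 1) (hf : f ∈ divModule a) :
    atkinU (etaQuot ^ s * f) ∈ divModule (a + 1) := by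
  have h1 : divModule a ≤
      (divModule (a + 1)).comap (atkinU ∘ₗ LinearMap.mulLeft ℤ (etaQuot ^ s)) := by
    refine Submodule.span_le.mpr ?_
    rintro _ ⟨j, hj, rfl⟩
    have h2 : (atkinU ∘ₗ LinearMap.mulLeft ℤ (etaQuot ^ s))
        (5 ^ (a + (5 * j - 5) / 2) * hauptmodul ^ j) =
        5 ^ (a + (5 * j - 5) / 2) * atkinU (hauptmodul ^ j * etaQuot ^ s) := by
      rw [LinearMap.comp_apply, LinearMap.mulLeft_apply]
      have h3 (n : ℕ) (g : ℤ⟦X⟧) : 5 ^ n * g = (5 ^ n : ℤ) • g := by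
        rw [zsmul_eq_mul]
        push_cast
        ring
      rw [h3 _ (atkinU _), ← map_smul, ← h3]
      congr 1
      ring
    rw [SetLike.mem_coe, Submodule.mem_comap, h2]
    refine mul_mem_of_mem_span (atkinU_hauptmodul_pow_mul_mem j s) ?_
    rintro _ ⟨l, hl, rfl⟩
    rw [← mul_assoc, ← pow_add]
    exact mul_mem_of_dvd (a := a + 1 + (5 * l - 5) / 2)
      (by obtain rfl | hj : j = 1 ∨ 2 ≤ j := by omega
          all_goals omega)
      (Submodule.subset_span ⟨l, by omega, rfl⟩)
  exact h1 hf

theorem trace_one_mem : trace 1 ∈ divModule 1 := by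
  rw [trace_one]
  exact Submodule.subset_span ⟨1, le_rfl, by simp⟩

theorem coeff_five_mul_sub_one (f : ℤ⟦X⟧) {n : ℕ} (hn : 1 ≤ n) :
    coeff (5 * n - 1) f = coeff n (atkinU (X * f)) := by
  rw [coeff_atkinU, ← coeff_succ_X_mul, Nat.sub_add_cancel (by omega)]

theorem X_mul_partitionSeries :
    X * partitionSeries =
      etaQuot * expand 5 (by norm_num) (expand 5 (by norm_num) partitionSeries) := by
  have h := congrArg (expand 5 (by norm_num)) expand_partitionSeries_mul
  rw [map_mul, map_one] at h
  rw [etaQuot, shifted, expand_twentyFive]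
  linear_combination -X * partitionSeries * h

theorem atkinU_X_mul_partitionSeries_mul (f g : ℤ⟦X⟧) :
    atkinU (X * (partitionSeries * f * expand 5 (by norm_num) g)) =
      expand 5 (by norm_num) partitionSeries * atkinU (etaQuot ^ 1 * f) * g := by
  have h : X * (partitionSeries * f * expand 5 (by norm_num) g) =
      expand 5 (by norm_num) (expand 5 (by norm_num) partitionSeries * g) * (etaQuot ^ 1 * f) := by
    rw [map_mul]
    linear_combination f * expand 5 (by norm_num) g * X_mul_partitionSeries
  rw [h, atkinU_expand_mul, mul_right_comm]

theorem exists_coeff_partitionSeries_mul_expand (i : ℕ) :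
    ∃ S ∈ divModule (2 * i + 1), ∀ (Y : ℤ⟦X⟧) (n N : ℕ),
      24 * N + 5 * 5 ^ (2 * i + 1) = 24 * 5 ^ (2 * i + 1) * n + 1 →
      coeff N (partitionSeries * expand (5 ^ (2 * i + 1)) (by positivity) Y) =
        coeff n (expand 5 (by norm_num) partitionSeries * S * Y) := by
  induction i with
  | zero =>
    refine ⟨trace 1, trace_one_mem, fun Y n N h ↦ ?_⟩
    have h1 : N = 5 * n - 1 := by omega
    have h2 := atkinU_X_mul_partitionSeries_mul 1 Y
    rw [mul_one, mul_one, ← trace] at h2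
    rw [h1, coeff_five_mul_sub_one _ (by omega), ← h2]
    rfl
  | succ i ih =>
    obtain ⟨S, hS, ih⟩ := ih
    refine ⟨atkinU (etaQuot ^ 1 * atkinU S), ?_, fun Y n N h ↦ ?_⟩
    · have := atkinU_mul_etaQuot_mem (s := 0) (by omega) hS
      rw [pow_zero, one_mul] at this
      exact atkinU_mul_etaQuot_mem le_rfl this
    · have hpow : 5 ^ (2 * (i + 1) + 1) = 25 * 5 ^ (2 * i + 1) := by ring
      have hpos : 0 < 5 ^ (2 * i + 1) := by positivity
      have hn : 1 ≤ n := by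
        by_contra! hn
        obtain rfl : n = 0 := by omega
        omega
      obtain ⟨m, rfl⟩ := Nat.exists_eq_add_of_le' hn
      have h1 : expand (5 ^ (2 * (i + 1) + 1)) (by positivity) Y =
          expand (5 ^ (2 * i + 1)) (by positivity)
            (expand 5 (by norm_num) (expand 5 (by norm_num) Y)) := by
        rw [← expand_twentyFive, ← expand_mul]
        congr 2
        rw [hpow, mul_comm]
      have h2 : 24 * N + 5 * 5 ^ (2 * i + 1) =
          24 * 5 ^ (2 * i + 1) * (5 * (5 * (m + 1) - 1)) + 1 := by
        rw [hpow] at h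
        rw [show 5 * (5 * (m + 1) - 1) = 25 * m + 20 by omega]
        linarith
      rw [h1, ih _ _ _ h2, ← coeff_atkinU, mul_assoc, mul_comm S, ← mul_assoc, ← map_mul,
        atkinU_expand_mul, mul_right_comm, coeff_five_mul_sub_one _ hn,
        atkinU_X_mul_partitionSeries_mul]

theorem exists_coeff_partitionSeries_mul_expand_partitionSeries (i b : ℕ) :
    ∃ S ∈ divModule (2 * i + 1 + b), ∀ n N : ℕ,
      24 * N + 6 * 5 ^ (2 * i + 1 + b) =
        24 * 5 ^ (2 * i + 1 + b) * n + 5 ^ (2 * i + 1) + 1 →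
      coeff N (partitionSeries * expand (5 ^ (2 * i + 1)) (by positivity) partitionSeries) =
        coeff n (expand 5 (by norm_num) partitionSeries * S * partitionSeries) := by
  induction b with
  | zero =>
    obtain ⟨S, hS, h⟩ := exists_coeff_partitionSeries_mul_expand i
    exact ⟨S, hS, fun n N hN ↦ h _ n N (by simp only [add_zero] at hN; omega)⟩
  | succ b ih =>
    obtain ⟨S, hS, ih⟩ := ih
    refine ⟨_, atkinU_mul_etaQuot_mem le_rfl hS, fun n N h ↦ ?_⟩
    have hpow : 5 ^ (2 * i + 1 + (b + 1)) = 5 * 5 ^ (2 * i + 1 + b) := by ring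
    have hle : 5 ^ (2 * i + 1) ≤ 5 ^ (2 * i + 1 + b) :=
      Nat.pow_le_pow_right (by norm_num) (by omega)
    have hpos : 0 < 5 ^ (2 * i + 1) := by positivity
    have hn : 1 ≤ n := by
      by_contra! hn
      obtain rfl : n = 0 := by omega
      omega
    obtain ⟨m, rfl⟩ := Nat.exists_eq_add_of_le' hn
    have h2 : 24 * N + 6 * 5 ^ (2 * i + 1 + b) =
        24 * 5 ^ (2 * i + 1 + b) * (5 * (m + 1) - 1) + 5 ^ (2 * i + 1) + 1 := by
      rw [hpow] at h
      rw [show 5 * (m + 1) - 1 = 5 * m + 4 by omega]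
      linarith
    rw [ih _ _ h2, coeff_five_mul_sub_one _ hn, mul_comm _ partitionSeries, mul_comm _ S,
      ← mul_assoc partitionSeries, atkinU_X_mul_partitionSeries_mul]

theorem exists_pow_five_eq (f : ℤ⟦X⟧) :
    ∃ g : ℤ⟦X⟧, f ^ 5 = expand 5 (by norm_num) f + 5 * g := by
  have : Fact (Nat.Prime 5) := ⟨by norm_num⟩
  have h (n : ℕ) : (5 : ℤ) ∣ coeff n (f ^ 5 - expand 5 (by norm_num) f) := by
    have h1 : (f.map (Int.castRingHom (ZMod 5))) ^ 5 =
        expand 5 (by norm_num) (f.map (Int.castRingHom (ZMod 5))) := by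
      refine (MvPowerSeries.map_frobenius_expand 5 (by norm_num)).symm.trans ?_
      rw [ZMod.frobenius_zmod]
      rw [MvPowerSeries.map_id]
      rfl
    refine (ZMod.intCast_zmod_eq_zero_iff_dvd _ 5).mp ?_
    have h2 := coeff_map (Int.castRingHom (ZMod 5)) n (f ^ 5 - expand 5 (by norm_num) f)
    rw [eq_intCast] at h2
    rw [← h2, map_sub, map_pow, h1, map_expand, sub_self, map_zero]
  choose g hg using h
  refine ⟨mk g, ?_⟩
  rw [← sub_eq_iff_eq_add']
  ext n
  have h5 : (5 : ℤ⟦X⟧) = C (5 : ℤ) := rfl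
  rw [hg, h5, coeff_C_mul, coeff_mk]

theorem pentagonalSeries_pow_three :
    pentagonalSeries ℤ ^ 3 = (part 0 (pentagonalSeries ℤ) ^ 3 -
        3 * shifted * part 2 (pentagonalSeries ℤ) ^ 2) +
      (part 2 (pentagonalSeries ℤ) ^ 3 - 3 * part 0 (pentagonalSeries ℤ) ^ 2 * shifted) +
      5 * shifted ^ 3 := by
  have h0 := part_zero_mul_part_two_eq_shifted
  have hE := eq_sum_part_shifted
  generalize part 0 (pentagonalSeries ℤ) = a at *
  generalize part 2 (pentagonalSeries ℤ) = b at *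
  generalize pentagonalSeries ℤ = E at *
  subst hE
  linear_combination (3 * a + 3 * b - 6 * shifted) * h0

theorem IsClass.add_zsmul {r : ZMod 5} {f g : ℤ⟦X⟧} (hf : IsClass r f) (c : ℤ)
    (hg : IsClass r g) : IsClass r (f + c • g) := fun n hn ↦ by
  rw [map_add, hf n hn, LinearMap.map_smul_of_tower, hg n hn, smul_zero, add_zero]

theorem five_dvd_coeff (n r : ℕ) (hr : r = 2 ∨ r = 3 ∨ r = 4) :
    5 ∣ coeff (5 * n + r)
      (expand 5 (by norm_num) (pentagonalSeries ℤ) ^ 5 * partitionSeries ^ 7) := by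
  obtain ⟨u, hu⟩ := exists_pow_five_eq partitionSeries
  set E := pentagonalSeries ℤ with hE
  obtain ⟨v, hv⟩ : ∃ v, expand 5 (by norm_num) E ^ 5 * partitionSeries ^ 7 =
      expand 5 (by norm_num) (E ^ 3) * (part 0 E ^ 3 + (-3 : ℤ) • (shifted * part 2 E ^ 2)) +
      expand 5 (by norm_num) (E ^ 3) * (part 2 E ^ 3 + (-3 : ℤ) • (part 0 E ^ 2 * shifted)) +
      5 * v := by
    have h1 : (partitionSeries * E) ^ 3 = 1 := by rw [partitionSeries_mul, one_pow]
    have h2 : (expand 5 (by norm_num) partitionSeries * expand 5 (by norm_num) E) ^ 2 = 1 := by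
      rw [expand_partitionSeries_mul, one_pow]
    have h3 := pentagonalSeries_pow_three
    rw [← hE] at h3
    rw [map_pow, zsmul_eq_mul, zsmul_eq_mul]
    push_cast
    refine ⟨expand 5 (by norm_num) E ^ 3 * shifted ^ 3 + expand 5 (by norm_num) E ^ 5 *
      (2 * u * expand 5 (by norm_num) partitionSeries + 5 * u ^ 2) * E ^ 3, ?_⟩
    linear_combination -expand 5 (by norm_num) E ^ 5 * partitionSeries ^ 7 * h1 +
      expand 5 (by norm_num) E ^ 5 * E ^ 3 * (partitionSeries ^ 5 +
        (expand 5 (by norm_num) partitionSeries + 5 * u)) * hu +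
      E ^ 3 * expand 5 (by norm_num) E ^ 3 * h2 + expand 5 (by norm_num) E ^ 3 * h3
  have h1 := (IsClass.expand (E ^ 3)).mul (((IsClass.part 0 E).pow 3).add_zsmul (-3)
    (isClass_shifted.mul ((IsClass.part 2 E).pow 2)))
  have h2 := (IsClass.expand (E ^ 3)).mul (((IsClass.part 2 E).pow 3).add_zsmul (-3)
    (((IsClass.part 0 E).pow 2).mul isClass_shifted))
  have h5 : (5 : ZMod 5) = 0 := rfl
  have h6 : (5 : ℤ⟦X⟧) = C (5 : ℤ) := rfl
  have hcast : ((5 * n + r : ℕ) : ZMod 5) = r := by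
    push_cast
    rw [h5, zero_mul, zero_add]
  rw [hv, map_add, map_add, h1, h2, zero_add, zero_add, h6, coeff_C_mul]
  · exact dvd_mul_right _ _
  all_goals
    rw [hcast]
    rcases hr with rfl | rfl | rfl <;> decide

theorem dvd_coeff_of_mem_divModule {a : ℕ} {S : ℤ⟦X⟧} (hS : S ∈ divModule a) (n r : ℕ)
    (hr : r = 2 ∨ r = 3 ∨ r = 4) :
    5 ^ (a + 1) ∣ coeff (5 * n + r + 1)
      (expand 5 (by norm_num) partitionSeries * S * partitionSeries) := by
  have h (n : ℕ) (f : ℤ⟦X⟧) (m : ℕ) : coeff m (5 ^ n * f) = 5 ^ n * coeff m f := by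
    have h5 : (5 : ℤ⟦X⟧) = C (5 : ℤ) := rfl
    rw [h5, ← map_pow, coeff_C_mul]
  refine Submodule.span_induction (p := fun S _ ↦ (5 : ℤ) ^ (a + 1) ∣ coeff (5 * n + r + 1)
      (expand 5 (by norm_num) partitionSeries * S * partitionSeries)) ?_ ?_ ?_ ?_ hS
  · rintro _ ⟨j, hj, rfl⟩
    rw [mul_left_comm, mul_assoc, h]
    obtain rfl | hj : j = 1 ∨ 2 ≤ j := by omega
    · rw [pow_succ]
      refine mul_dvd_mul (by simp) ?_
      have h1 : expand 5 (by norm_num) partitionSeries * hauptmodul ^ 1 * partitionSeries =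
          X * (expand 5 (by norm_num) (pentagonalSeries ℤ) ^ 5 * partitionSeries ^ 7) := by
        rw [hauptmodul]
        linear_combination X * expand 5 (by norm_num) (pentagonalSeries ℤ) ^ 5 *
          partitionSeries ^ 7 * expand_partitionSeries_mul
      rw [h1, coeff_succ_X_mul]
      exact five_dvd_coeff n r hr
    · exact (pow_dvd_pow 5 (by omega)).mul_right _
  · simp
  · intro f g _ _ hf hg
    rw [mul_add, add_mul, map_add]
    exact dvd_add hf hg
  · intro c f _ hf
    rw [mul_smul_comm, smul_mul_assoc, LinearMap.map_smul_of_tower, smul_eq_mul]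
    exact hf.mul_left _

end EulerSeries

/-- For all `n, β ≥ 0`, `k ≥ 1` and `r ∈ {2, 3, 4}`, `24` divides
`(24r+18)·5^{2k+β-1} + 5^{2k-1} + 1` and
`p_{1,5^{2k-1}}(5^{2k+β} n + ((24r+18)·5^{2k+β-1} + 5^{2k-1} + 1)/24) ≡ 0 (mod 5^{2k+β})`. -/
theorem twoColorCongruence_odd_r (n β k r : ℕ) (hk : 1 ≤ k)
    (hr : r ∈ ({2, 3, 4} : Set ℕ)) :
    24 ∣ (24 * r + 18) * 5 ^ (2 * k + β - 1) + 5 ^ (2 * k - 1) + 1 ∧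
      5 ^ (2 * k + β) ∣
        p1 (5 ^ (2 * k - 1))
          (5 ^ (2 * k + β) * n +
            ((24 * r + 18) * 5 ^ (2 * k + β - 1) + 5 ^ (2 * k - 1) + 1) / 24) := by
  obtain ⟨i, rfl⟩ := Nat.exists_eq_add_of_le' hk
  have hr' : r = 2 ∨ r = 3 ∨ r = 4 := by simpa using hr
  rw [show 2 * (i + 1) + β - 1 = 2 * i + 1 + β by omega,
    show 2 * (i + 1) - 1 = 2 * i + 1 by omega,
    show 2 * (i + 1) + β = 2 * i + 1 + β + 1 by omega]
  have h1 : 5 ^ (2 * i + 1) % 24 = 5 := by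
    rw [pow_succ, pow_mul, Nat.mul_mod, Nat.pow_mod]
    norm_num
  have h2 : 5 ^ β % 24 = 1 ∨ 5 ^ β % 24 = 5 := by
    induction β with
    | zero => simp
    | succ b ih => omega
  have h3 : (18 * 5 ^ (2 * i + 1 + β)) % 24 = 18 := by
    rw [pow_add, Nat.mul_mod, Nat.mul_mod (5 ^ _), h1]
    rcases h2 with h2 | h2 <;> rw [h2]
  have hdvd : 24 ∣ (24 * r + 18) * 5 ^ (2 * i + 1 + β) + 5 ^ (2 * i + 1) + 1 := by
    rw [add_mul, mul_assoc]
    omega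
  refine ⟨hdvd, ?_⟩
  obtain ⟨c, hc⟩ := hdvd
  obtain ⟨S, hS, h⟩ :=
    EulerSeries.exists_coeff_partitionSeries_mul_expand_partitionSeries i β
  rw [hc, Nat.mul_div_cancel_left _ (by norm_num), ← Int.natCast_dvd_natCast,
    EulerSeries.natCast_p1 _ (by positivity), h (5 * n + r + 1)]
  · exact_mod_cast EulerSeries.dvd_coeff_of_mem_divModule hS n r hr'
  · rw [pow_succ]
    linarith
end

section
/- For all integers n ≥ 0, β ≥ 0 and k ≥ 1, the number 24 divides 22·5^{2k+2β+2} + 5^{2k} + 1, and p_{1,5^{2k}}(5^{2k+2β+2}·n + (22·5^{2k+2β+2} + 5^{2k} + 1)/24) ≡ 0 (mod 5^{2k+β+1}). -/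
open PowerSeries


namespace TwoColorPartition

section Products

open PowerSeries.WithPiTopology

variable {R : Type*} [CommRing R] [TopologicalSpace R]

theorem continuous_expand (p : ℕ) (hp : p ≠ 0) :
    Continuous (expand p hp : R⟦X⟧ → R⟦X⟧) := by
  refine continuous_iff_continuousAt.2 fun f => ?_
  refine (WithPiTopology.tendsto_iff_coeff_tendsto R _ _ _).2 fun d => ?_
  by_cases h : p ∣ d
  · simpa only [coeff_expand, if_pos h] using (continuous_coeff R (d / p)).tendsto f
  · simpa only [coeff_expand, if_neg h] using tendsto_const_nhds

theorem continuous_rescale [IsTopologicalRing R] (a : R) :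
    Continuous (rescale a : R⟦X⟧ → R⟦X⟧) := by
  refine continuous_iff_continuousAt.2 fun f => ?_
  refine (WithPiTopology.tendsto_iff_coeff_tendsto R _ _ _).2 fun d => ?_
  simpa only [coeff_rescale] using ((continuous_coeff R d).tendsto f).const_mul (a ^ d)

theorem hasProd_expand_pentagonalSeries (p : ℕ) (hp : p ≠ 0) :
    HasProd (fun n => (1 - X ^ (p * (n + 1)) : R⟦X⟧)) (expand p hp (pentagonalSeries R)) := by
  have h := (hasProd_one_sub_X_pow R).map (expand p hp (R := R)) (continuous_expand p hp)
  simpa [Function.comp_def, ← pow_mul] using h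

theorem hasProd_rescale_pentagonalSeries [IsTopologicalRing R] (a : R) :
    HasProd (fun n => (1 - C (a ^ (n + 1)) * X ^ (n + 1) : R⟦X⟧))
      (rescale a (pentagonalSeries R)) := by
  have h := (hasProd_one_sub_X_pow R).map (rescale a) (continuous_rescale a)
  simpa [Function.comp_def, rescale_X, mul_pow] using h

theorem hasProd_ite_dvd {M : Type*} [CommMonoid M] [TopologicalSpace M] {p : ℕ} (hp : p ≠ 0)
    {g : ℕ → M} {a : M} (h : HasProd (fun n => g (p * (n + 1))) a) :
    HasProd (fun n => if p ∣ n + 1 then g (n + 1) else 1) a := by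
  have hpos : ∀ n, p * (n + 1) - 1 + 1 = p * (n + 1) := fun n =>
    Nat.sub_add_cancel (Nat.mul_pos (Nat.pos_of_ne_zero hp) n.succ_pos)
  have hinj : Function.Injective fun n => p * (n + 1) - 1 := by
    intro m n hmn
    have : p * (m + 1) = p * (n + 1) := by
      rw [← hpos m, ← hpos n]
      exact congrArg (· + 1) hmn
    simpa using Nat.eq_of_mul_eq_mul_left (Nat.pos_of_ne_zero hp) this
  rw [← hinj.hasProd_iff]
  · simpa [Function.comp_def, hpos] using h
  · intro n hn
    rw [if_neg]
    rintro ⟨c, hc⟩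
    refine hn ⟨c - 1, ?_⟩
    have : c ≠ 0 := by rintro rfl; simp at hc
    change p * (c - 1 + 1) - 1 = n
    rw [Nat.sub_add_cancel (Nat.pos_of_ne_zero this), ← hc, Nat.add_sub_cancel]

end Products

/-- The generating function of partitions into multiples of `ℓ` is inverse to
`∏ (1 - X ^ (ℓ n))`. -/
theorem mk_card_dvd_mul_expand (ℓ : ℕ) (hℓ : ℓ ≠ 0) :
    (PowerSeries.mk fun n =>
      (Fintype.card {μ : Nat.Partition n // ∀ i ∈ μ.parts, ℓ ∣ i} : ℤ)) *
      expand ℓ hℓ (pentagonalSeries ℤ) = 1 := by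
  open PowerSeries.WithPiTopology in
  have h1 := Nat.Partition.hasProd_powerSeriesMk_card_restricted ℤ (fun i => ℓ ∣ i)
  have h2 := hasProd_ite_dvd hℓ (g := fun k => (1 - X ^ k : ℤ⟦X⟧))
    (hasProd_expand_pentagonalSeries ℓ hℓ)
  have h := h1.mul h2
  have h3 : (fun i => (if ℓ ∣ i + 1 then ∑' j : ℕ, (X : ℤ⟦X⟧) ^ ((i + 1) * j) else 1) *
      if ℓ ∣ i + 1 then 1 - X ^ (i + 1) else 1) = fun _ => 1 := by
    funext i
    split_ifs
    · simp_rw [pow_mul]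
      exact tsum_pow_mul_one_sub_of_constantCoeff_eq_zero (by simp)
    · simp
  rw [h3] at h
  have h4 := h.unique hasProd_one
  convert h4 using 3
  ext n
  simp only [Nat.cast_inj, Nat.Partition.restricted]
  rw [Fintype.card_subtype]

/-- The generating function of the partition numbers. -/
noncomputable def partitionSeries : ℤ⟦X⟧ := .mk fun n => (Fintype.card (Nat.Partition n) : ℤ)

theorem partitionSeries_mul : partitionSeries * pentagonalSeries ℤ = 1 := by
  have h := mk_card_dvd_mul_expand 1 one_ne_zero
  rw [expand_one_apply] at h
  convert h using 3
  unfold partitionSeries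
  congr 1
  funext n
  rw [Nat.cast_inj]
  exact Fintype.card_congr (Equiv.subtypeUnivEquiv fun _ _ _ => one_dvd _).symm

theorem coeff_partitionSeries_mul_expand (ℓ : ℕ) (hℓ : ℓ ≠ 0) (n : ℕ) :
    coeff n (partitionSeries * expand ℓ hℓ partitionSeries) = (p1 ℓ n : ℤ) := by
  have h : expand ℓ hℓ partitionSeries = .mk fun n =>
      (Fintype.card {μ : Nat.Partition n // ∀ i ∈ μ.parts, ℓ ∣ i} : ℤ) := by
    have h1 := mk_card_dvd_mul_expand ℓ hℓ
    have h2 := congrArg (expand ℓ hℓ) partitionSeries_mul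
    rw [map_mul, map_one] at h2
    exact (left_inv_eq_right_inv h1 (by rw [mul_comm]; exact h2)).symm
  rw [h, coeff_mul, Finset.Nat.sum_antidiagonal_eq_sum_range_succ_mk, p1]
  push_cast
  simp [partitionSeries]

section Dissection

/-- All exponents of `f` lie in the residue class `r` modulo `5`. -/
def SupportedMod {R : Type*} [Semiring R] (r : ZMod 5) (f : R⟦X⟧) : Prop :=
  ∀ n : ℕ, (n : ZMod 5) ≠ r → coeff n f = 0

theorem SupportedMod.mul {R : Type*} [Semiring R] {r s : ZMod 5} {f g : R⟦X⟧}
    (hf : SupportedMod r f) (hg : SupportedMod s g) : SupportedMod (r + s) (f * g) := by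
  intro n hn
  rw [coeff_mul]
  refine Finset.sum_eq_zero fun x hx => ?_
  rw [Finset.HasAntidiagonal.mem_antidiagonal] at hx
  by_cases h1 : (x.1 : ZMod 5) = r
  · rw [hg x.2 fun h2 => hn (by rw [← hx, Nat.cast_add, h1, h2]), mul_zero]
  · rw [hf x.1 h1, zero_mul]

theorem SupportedMod.pow {R : Type*} [CommSemiring R] {r : ZMod 5} {f : R⟦X⟧}
    (hf : SupportedMod r f) (k : ℕ) : SupportedMod (k * r) (f ^ k) := by
  induction k with
  | zero =>
    intro n hn
    rw [pow_zero, coeff_one, if_neg]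
    rintro rfl
    simp at hn
  | succ k ih =>
    rw [pow_succ, Nat.cast_succ, add_mul, one_mul]
    exact ih.mul hf

theorem supportedMod_X : SupportedMod 1 (X : ℤ⟦X⟧) := by
  intro n hn
  rw [coeff_X, if_neg]
  rintro rfl
  simp at hn

/-- The part of `f` whose exponents lie in the residue class `r` modulo `5`. -/
noncomputable def residuePart {R : Type*} [Semiring R] (r : ZMod 5) (f : R⟦X⟧) : R⟦X⟧ :=
  .mk fun n => if (n : ZMod 5) = r then coeff n f else 0

theorem supportedMod_residuePart {R : Type*} [Semiring R] (r : ZMod 5) (f : R⟦X⟧) :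
    SupportedMod r (residuePart r f) := by
  intro n hn
  rw [residuePart, coeff_mk, if_neg hn]

theorem rescale_of_supportedMod {R : Type*} [CommSemiring R] {r : ℕ} {f : R⟦X⟧}
    (hf : SupportedMod r f) {w : R} (hw : w ^ 5 = 1) : rescale w f = C w ^ r * f := by
  ext n
  rw [coeff_rescale, ← map_pow, coeff_C_mul]
  by_cases h : (n : ZMod 5) = r
  · have h1 : n % 5 = r % 5 := (ZMod.natCast_eq_natCast_iff n r 5).1 h
    rw [pow_eq_pow_mod n hw, h1, ← pow_eq_pow_mod r hw]
  · rw [hf n h, mul_zero, mul_zero]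

theorem coeff_pentagonalSeries_cast {R : Type*} [CommRing R] (n : ℕ) :
    coeff n (pentagonalSeries R) = ((coeff n (pentagonalSeries ℤ) : ℤ) : R) := by
  by_cases h : n ∈ Set.range pentagonal
  · obtain ⟨k, rfl⟩ := h
    rw [coeff_pentagonalSeries_pentagonal, coeff_pentagonalSeries_pentagonal]
    simp
  · rw [coeff_pentagonalSeries_eq_zero _ h, coeff_pentagonalSeries_eq_zero _ h, Int.cast_zero]

theorem map_pentagonalSeries {R : Type*} [CommRing R] :
    PowerSeries.map (Int.castRingHom R) (pentagonalSeries ℤ) = pentagonalSeries R := by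
  ext n
  rw [coeff_map, coeff_pentagonalSeries_cast (R := R)]
  rfl

theorem pentagonal_mod_five (m : ℤ) : (pentagonal m : ℤ) % 5 =
    if m % 5 = 0 ∨ m % 5 = 2 then 0 else if m % 5 = 1 then 1 else 2 := by
  have h := two_mul_natCast_pentagonal m
  obtain ⟨c, r, hm, hr⟩ : ∃ c r : ℤ, m = 5 * c + r ∧ (r = 0 ∨ r = 1 ∨ r = 2 ∨ r = 3 ∨ r = 4) :=
    ⟨m / 5, m % 5, by omega, by omega⟩
  have h2 : 2 * (pentagonal m : ℤ) = 5 * (15 * (c * c) + 6 * (c * r) - c) + r * (3 * r - 1) := by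
    rw [h, hm]; ring
  generalize (pentagonal m : ℤ) = p at *
  generalize c * c = x at *
  rcases hr with rfl | rfl | rfl | rfl | rfl <;> split_ifs <;> omega

/-- The residue of a pentagonal number modulo `5`. -/
theorem natCast_pentagonal_zmod (m : ℤ) : ((pentagonal m : ℕ) : ZMod 5) =
    if m % 5 = 0 ∨ m % 5 = 2 then 0 else if m % 5 = 1 then 1 else 2 := by
  have h := pentagonal_mod_five m
  have key : ∀ r : ℕ, (pentagonal m : ℤ) % 5 = r → ((pentagonal m : ℕ) : ZMod 5) = r := by
    intro r hr
    rw [ZMod.natCast_eq_natCast_iff', ← Int.natCast_inj]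
    push_cast
    omega
  split_ifs at h ⊢
  · exact_mod_cast key 0 h
  · exact_mod_cast key 1 h
  · exact_mod_cast key 2 h

theorem pentagonalSeries_eq_add_residueParts : pentagonalSeries ℤ =
    residuePart 0 (pentagonalSeries ℤ) + residuePart 1 (pentagonalSeries ℤ) +
      residuePart 2 (pentagonalSeries ℤ) := by
  ext n
  simp only [map_add, residuePart, coeff_mk]
  have h01 : (0 : ZMod 5) ≠ 1 := by decide
  have h02 : (0 : ZMod 5) ≠ 2 := by decide
  have h12 : (1 : ZMod 5) ≠ 2 := by decide
  by_cases h : n ∈ Set.range pentagonal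
  · obtain ⟨k, rfl⟩ := h
    rw [natCast_pentagonal_zmod]
    split_ifs <;> simp_all
  · simp [coeff_pentagonalSeries_eq_zero _ h]

theorem residuePart_one_pentagonalSeries : residuePart 1 (pentagonalSeries ℤ) =
    -(X * expand 5 (by norm_num) (expand 5 (by norm_num) (pentagonalSeries ℤ))) := by
  have key : ∀ m : ℤ, m % 5 = 1 → ∃ l : ℤ, m = 5 * l + 1 ∧
      pentagonal m = 25 * pentagonal (-l) + 1 := by
    intro m hm
    refine ⟨m / 5, by omega, ?_⟩
    have h1 := two_mul_natCast_pentagonal m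
    have h2 := two_mul_natCast_pentagonal_neg (m / 5)
    obtain ⟨l, hl⟩ : ∃ l, m = 5 * l + 1 := ⟨m / 5, by omega⟩
    have h3 : m / 5 = l := by omega
    rw [h3] at h2 ⊢
    rw [hl] at h1 ⊢
    have : 2 * (pentagonal (5 * l + 1) : ℤ) = 2 * (25 * pentagonal (-l) + 1) := by
      linear_combination h1 - 25 * h2
    omega
  rw [← expand_mul]
  ext n
  rw [residuePart, coeff_mk, map_neg]
  rcases n with _ | n
  · have h01 : (0 : ZMod 5) ≠ 1 := by decide
    simp [h01]
  rw [coeff_succ_X_mul, coeff_expand]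
  by_cases h : n + 1 ∈ Set.range pentagonal
  · obtain ⟨m, hm⟩ := h
    rw [← hm]
    by_cases h1 : m % 5 = 1
    · obtain ⟨l, hl, hp⟩ := key m h1
      have hn : n = 25 * pentagonal (-l) := by omega
      have h5 : n / 25 = pentagonal (-l) := by omega
      have hres : ((pentagonal m : ℕ) : ZMod 5) = 1 := by
        rw [natCast_pentagonal_zmod, if_neg (by omega), if_pos h1]
      rw [if_pos hres, coeff_pentagonalSeries_pentagonal,
        if_pos (by omega), show 5 * 5 = 25 from rfl, h5, coeff_pentagonalSeries_pentagonal, hl]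
      rcases Int.even_or_odd l with he | ho
      · rw [Int.negOnePow_even (-l) he.neg, Int.negOnePow_odd _ (by
          obtain ⟨k, hk⟩ := he; exact ⟨5 * k, by omega⟩)]
        simp
      · rw [Int.negOnePow_odd (-l) ho.neg, Int.negOnePow_even _ (by
          obtain ⟨k, hk⟩ := ho; exact ⟨5 * k + 3, by omega⟩)]
        simp
    · have hn : ¬ 5 * 5 ∣ n := by
        intro hd
        have := pentagonal_mod_five m
        rw [hm] at this
        split_ifs at this <;> push_cast at this <;> omega
      rw [if_neg hn, if_neg, neg_zero]
      rw [natCast_pentagonal_zmod]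
      split_ifs <;> decide
  · rw [coeff_pentagonalSeries_eq_zero _ h, ite_self]
    split_ifs with hd
    · rw [coeff_pentagonalSeries_eq_zero, neg_zero]
      rintro ⟨l, hl⟩
      refine h ⟨5 * (-l) + 1, ?_⟩
      obtain ⟨l', hl', hp⟩ := key (5 * (-l) + 1) (by omega)
      obtain rfl : l' = -l := by omega
      rw [hp, neg_neg, hl]
      omega
    · rw [neg_zero]

/-- A family of power series whose members are concentrated at exponents that tend to infinity is
summable. -/
theorem summable_of_coeff_ne_zero {ι R : Type*} [Semiring R] [TopologicalSpace R]
    {f : ι → R⟦X⟧} (e : ι → ℕ) (he : ∀ d, (e ⁻¹' {d}).Finite)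
    (hf : ∀ i d, coeff d (f i) ≠ 0 → e i = d) :
    letI := WithPiTopology.instTopologicalSpace R; Summable f := by
  refine (WithPiTopology.summable_iff_summable_coeff R).2 fun d => ?_
  exact summable_of_hasFiniteSupport ((he d).subset fun i hi => hf i d hi)

theorem finite_pentagonal_add_preimage (d : ℕ) :
    ((fun x : ℤ × ℤ => pentagonal x.1 + pentagonal x.2) ⁻¹' {d}).Finite := by
  have h := (Set.finite_Iic d).preimage (pentagonal_injective.injOn)
  refine (h.prod h).subset ?_
  rintro ⟨m, n⟩ hx
  simp only [Set.mem_preimage, Set.mem_singleton_iff] at hx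
  simp only [Set.mem_prod, Set.mem_preimage, Set.mem_Iic]
  omega

/-- The term of index `m` in the pentagonal number series. -/
noncomputable def pentagonalTerm (m : ℤ) : ℤ⟦X⟧ := (Int.negOnePow m : ℤ⟦X⟧) * X ^ pentagonal m

theorem pentagonalTerm_mul (m n : ℤ) : pentagonalTerm m * pentagonalTerm n =
    (Int.negOnePow (m + n) : ℤ⟦X⟧) * X ^ (pentagonal m + pentagonal n) := by
  rw [pentagonalTerm, pentagonalTerm, Int.negOnePow_add, pow_add]
  push_cast
  ring

theorem coeff_negOnePow_mul_X_pow (m : ℤ) (k d : ℕ) :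
    coeff d ((Int.negOnePow m : ℤ⟦X⟧) * X ^ k) = if d = k then (Int.negOnePow m : ℤ) else 0 := by
  rcases Int.even_or_odd m with h | h
  · simp [Int.negOnePow_even m h, coeff_X_pow]
  · simp [Int.negOnePow_odd m h, coeff_X_pow, apply_ite]

/-- A reflection of `ℤ × ℤ`, in the coordinates `6 m - 1`, that preserves the sum of two
pentagonal numbers on the sublattice `3 m + 4 n ≡ 2` modulo `5`. -/
def reflection (x : ℤ × ℤ) : ℤ × ℤ :=
  if (3 * x.1 + 4 * x.2) % 5 = 2 then
    ((2 - 3 * x.1 - 4 * x.2) / 5, (3 * x.2 - 4 * x.1 + 1) / 5)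
  else x

theorem reflection_spec {m n : ℤ} (h : (3 * m + 4 * n) % 5 = 2) : ∃ M N : ℤ,
    reflection (m, n) = (M, N) ∧ 5 * M = 2 - 3 * m - 4 * n ∧ 5 * N = 3 * n - 4 * m + 1 ∧
      (3 * M + 4 * N) % 5 = 2 :=
  ⟨_, _, by simp only [reflection]; rw [if_pos h], by omega, by omega, by omega⟩

theorem reflection_involutive : Function.Involutive reflection := by
  rintro ⟨m, n⟩
  by_cases h : (3 * m + 4 * n) % 5 = 2
  · obtain ⟨M, N, h1, h2, h3, h4⟩ := reflection_spec h
    obtain ⟨M', N', h1', h2', h3', -⟩ := reflection_spec h4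
    rw [h1, h1', Prod.mk.injEq]
    omega
  · have : reflection (m, n) = (m, n) := by
      simp only [reflection]; rw [if_neg h]
    rw [this, this]

/-- The terms of the square of the pentagonal number series on a sublattice of index `5`. -/
noncomputable def latticeTerm (x : ℤ × ℤ) : ℤ⟦X⟧ :=
  if (3 * x.1 + 4 * x.2) % 5 = 2 then pentagonalTerm x.1 * pentagonalTerm x.2 else 0

theorem latticeTerm_reflection (x : ℤ × ℤ) : latticeTerm (reflection x) = -latticeTerm x := by
  obtain ⟨m, n⟩ := x
  by_cases h : (3 * m + 4 * n) % 5 = 2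
  · obtain ⟨M, N, h1, h2, h3, h4⟩ := reflection_spec h
    rw [h1, latticeTerm, latticeTerm]
    simp only
    rw [if_pos h4, if_pos h, pentagonalTerm_mul, pentagonalTerm_mul]
    have hp : pentagonal M + pentagonal N = pentagonal m + pentagonal n := by
      have hM := two_mul_natCast_pentagonal M
      have hN := two_mul_natCast_pentagonal N
      have hm := two_mul_natCast_pentagonal m
      have hn := two_mul_natCast_pentagonal n
      have : 50 * ((pentagonal M : ℤ) + pentagonal N) = 50 * (pentagonal m + pentagonal n) := by
        linear_combination 25 * hM + 25 * hN - 25 * hm - 25 * hn +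
          (15 * M + 3 * (2 - 3 * m - 4 * n) - 5) * h2 +
          (15 * N + 3 * (3 * n - 4 * m + 1) - 5) * h3
      omega
    rw [hp]
    rcases Int.even_or_odd (m + n) with he | ho
    · rw [Int.negOnePow_even _ he, Int.negOnePow_odd _ (Int.odd_iff.2 (by
        rw [Int.even_iff] at he; omega))]
      simp
    · rw [Int.negOnePow_odd _ ho, Int.negOnePow_even _ (Int.even_iff.2 (by
        rw [Int.odd_iff] at ho; omega))]
      simp
  · have : reflection (m, n) = (m, n) := by
      simp only [reflection]; rw [if_neg h]
    rw [this, latticeTerm]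
    simp only
    rw [if_neg h, neg_zero]

open PowerSeries.WithPiTopology in
theorem hasSum_latticeTerm : HasSum latticeTerm 0 := by
  have hs : Summable latticeTerm := by
    refine summable_of_coeff_ne_zero _ finite_pentagonal_add_preimage ?_
    rintro ⟨m, n⟩ d hd
    rw [latticeTerm] at hd
    simp only at hd
    split_ifs at hd
    · rw [pentagonalTerm_mul, coeff_negOnePow_mul_X_pow] at hd
      by_contra hne
      exact hd (if_neg (Ne.symm hne))
    · simp at hd
  obtain ⟨s, hs⟩ := hs
  have h1 : HasSum (latticeTerm ∘ reflection) s :=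
    (reflection_involutive.toPerm.hasSum_iff (f := latticeTerm)).2 hs
  rw [show latticeTerm ∘ reflection = fun x => -latticeTerm x from
    funext latticeTerm_reflection] at h1
  have h2 : s = -s := h1.unique hs.neg
  have h3 : (2 : ℤ⟦X⟧) * s = 0 := by linear_combination h2
  rcases mul_eq_zero.1 h3 with h | h
  · exact absurd (congrArg constantCoeff h) (by rw [map_ofNat]; simp)
  · rwa [h] at hs

open PowerSeries.WithPiTopology in
theorem hasSum_residuePart (r : ZMod 5) :
    HasSum (fun m => if ((pentagonal m : ℕ) : ZMod 5) = r then pentagonalTerm m else 0)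
      (residuePart r (pentagonalSeries ℤ)) := by
  rw [hasSum_iff_hasSum_coeff]
  intro d
  have h := (hasSum_iff_hasSum_coeff ℤ).1 (hasSum_pentagonalSeries ℤ) d
  rw [residuePart, coeff_mk]
  split_ifs with hd
  · convert h using 2 with m
    split_ifs with hm
    · rfl
    · rw [map_zero, coeff_negOnePow_mul_X_pow, if_neg]
      rintro rfl
      exact hm hd
  · have hz : (fun m => coeff d (if ((pentagonal m : ℕ) : ZMod 5) = r then
        pentagonalTerm m else 0)) = fun _ => 0 := by
      funext m
      split_ifs with hm
      · rw [pentagonalTerm, coeff_negOnePow_mul_X_pow, if_neg]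
        rintro rfl
        exact hd hm
      · rw [map_zero]
    rw [hz]
    exact hasSum_zero

open PowerSeries.WithPiTopology in
theorem hasSum_residuePart_mul (r s : ZMod 5) :
    HasSum (fun x : ℤ × ℤ =>
      if ((pentagonal x.1 : ℕ) : ZMod 5) = r ∧ ((pentagonal x.2 : ℕ) : ZMod 5) = s then
        pentagonalTerm x.1 * pentagonalTerm x.2 else 0)
      (residuePart r (pentagonalSeries ℤ) * residuePart s (pentagonalSeries ℤ)) := by
  let F (r : ZMod 5) (m : ℤ) : ℤ⟦X⟧ :=
    if ((pentagonal m : ℕ) : ZMod 5) = r then pentagonalTerm m else 0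
  have key : (fun x : ℤ × ℤ =>
      if ((pentagonal x.1 : ℕ) : ZMod 5) = r ∧ ((pentagonal x.2 : ℕ) : ZMod 5) = s then
        pentagonalTerm x.1 * pentagonalTerm x.2 else 0) = fun x => F r x.1 * F s x.2 := by
    funext x
    simp only [F]
    rw [ite_and]
    split_ifs <;> simp
  have hs : Summable fun x : ℤ × ℤ =>
      if ((pentagonal x.1 : ℕ) : ZMod 5) = r ∧ ((pentagonal x.2 : ℕ) : ZMod 5) = s then
        pentagonalTerm x.1 * pentagonalTerm x.2 else 0 := by
    refine summable_of_coeff_ne_zero _ finite_pentagonal_add_preimage ?_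
    rintro ⟨m, n⟩ d hd
    simp only at hd
    split_ifs at hd
    · rw [pentagonalTerm_mul, coeff_negOnePow_mul_X_pow] at hd
      by_contra hne
      exact hd (if_neg (Ne.symm hne))
    · simp at hd
  rw [key] at hs ⊢
  have hF : ∀ r, HasSum (F r) (residuePart r (pentagonalSeries ℤ)) := hasSum_residuePart
  clear_value F
  exact (hF r).mul (hF s) hs

/-- Ramanujan's relation between the parts of Euler's product modulo `5`. -/
theorem residuePart_zero_mul_residuePart_two :
    residuePart 0 (pentagonalSeries ℤ) * residuePart 2 (pentagonalSeries ℤ) =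
      -residuePart 1 (pentagonalSeries ℤ) ^ 2 := by
  open PowerSeries.WithPiTopology in
  have h1 := hasSum_latticeTerm.add ((Equiv.prodComm ℤ ℤ).hasSum_iff.2 hasSum_latticeTerm)
  have h2 := ((hasSum_residuePart_mul 0 2).add (hasSum_residuePart_mul 2 0)).add
    ((hasSum_residuePart_mul 1 1).add (hasSum_residuePart_mul 1 1))
  have h3 := h1.unique (h2.congr_fun ?_)
  · have h4 : (2 : ℤ⟦X⟧) * (residuePart 0 (pentagonalSeries ℤ) *
        residuePart 2 (pentagonalSeries ℤ) + residuePart 1 (pentagonalSeries ℤ) ^ 2) = 0 := by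
      linear_combination -h3
    rcases mul_eq_zero.1 h4 with h | h
    · exact absurd (congrArg constantCoeff h) (by rw [map_ofNat]; simp)
    · exact eq_neg_of_add_eq_zero_left h
  · rintro ⟨m, n⟩
    have h02 : (0 : ZMod 5) ≠ 2 := by decide
    have h12 : (1 : ZMod 5) ≠ 2 := by decide
    have h01 : (0 : ZMod 5) ≠ 1 := by decide
    have hm : m % 5 = 0 ∨ m % 5 = 1 ∨ m % 5 = 2 ∨ m % 5 = 3 ∨ m % 5 = 4 := by omega
    have hn : n % 5 = 0 ∨ n % 5 = 1 ∨ n % 5 = 2 ∨ n % 5 = 3 ∨ n % 5 = 4 := by omega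
    simp only [latticeTerm, Function.comp_apply, Equiv.prodComm_apply, Prod.swap_prod_mk,
      natCast_pentagonal_zmod]
    rw [mul_comm (pentagonalTerm n)]
    rcases hm with hm | hm | hm | hm | hm <;> rcases hn with hn | hn | hn | hn | hn <;>
      simp [hm, hn, Int.add_emod, Int.mul_emod, h01, h02, h12, h01.symm, h02.symm, h12.symm]


theorem prod_one_sub_pow_mul {R : Type*} [CommRing R] {w : R}
    (hsum : 1 + w + w ^ 2 + w ^ 3 + w ^ 4 = 0) (x : R) :
    (1 - x) * (1 - w * x) * (1 - w ^ 2 * x) * (1 - w ^ 3 * x) * (1 - w ^ 4 * x) = 1 - x ^ 5 := by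
  have hw : w ^ 5 = 1 := by linear_combination (w - 1) * hsum
  have h1 : (1 - w * x) * (1 - w ^ 4 * x) = 1 - (w + w ^ 4) * x + x ^ 2 := by
    linear_combination x ^ 2 * hw
  have h2 : (1 - w ^ 2 * x) * (1 - w ^ 3 * x) = 1 - (w ^ 2 + w ^ 3) * x + x ^ 2 := by
    linear_combination x ^ 2 * hw
  have h3 : (w + w ^ 4) * (w ^ 2 + w ^ 3) = -1 := by
    linear_combination hsum + (w + w ^ 2) * hw
  linear_combination (1 - x) * (1 - w ^ 2 * x) * (1 - w ^ 3 * x) * h1 +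
    (1 - x) * (1 - (w + w ^ 4) * x + x ^ 2) * h2 + (1 - x) * x ^ 2 * h3 +
    (1 - x) * (-x - x ^ 3) * hsum

open PowerSeries.WithPiTopology in
theorem prod_rescale_pentagonalSeries {R : Type*} [CommRing R] [TopologicalSpace R]
    [IsTopologicalRing R] [T2Space R] {w : R} (hsum : 1 + w + w ^ 2 + w ^ 3 + w ^ 4 = 0)
    (h5 : (5 : ℕ) ≠ 0) :
    rescale (w ^ 0) (pentagonalSeries R) * rescale (w ^ 1) (pentagonalSeries R) *
      rescale (w ^ 2) (pentagonalSeries R) * rescale (w ^ 3) (pentagonalSeries R) *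
      rescale (w ^ 4) (pentagonalSeries R) * expand 5 h5 (expand 5 h5 (pentagonalSeries R)) =
    expand 5 h5 (pentagonalSeries R) ^ 6 := by
  have hw : w ^ 5 = 1 := by linear_combination (w - 1) * hsum
  have hl := (((((hasProd_rescale_pentagonalSeries (w ^ 0)).mul
    (hasProd_rescale_pentagonalSeries (w ^ 1))).mul
    (hasProd_rescale_pentagonalSeries (w ^ 2))).mul
    (hasProd_rescale_pentagonalSeries (w ^ 3))).mul
    (hasProd_rescale_pentagonalSeries (w ^ 4))).mul
    (hasProd_ite_dvd h5 (g := fun k => (1 - X ^ (5 * k) : R⟦X⟧)) (by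
      have := hasProd_expand_pentagonalSeries (R := R) (5 * 5) (by norm_num)
      rw [expand_mul (hp := h5) (hq := h5)] at this
      simpa only [mul_assoc] using this))
  have hr := (hasProd_expand_pentagonalSeries (R := R) 5 h5)
  have hr5 := hasProd_ite_dvd h5 (g := fun k => (1 - X ^ k : R⟦X⟧)) hr
  have hr6 := hr.mul (hr5.mul (hr5.mul (hr5.mul (hr5.mul hr5))))
  rw [show expand 5 h5 (pentagonalSeries R) ^ 6 = expand 5 h5 (pentagonalSeries R) *
    (expand 5 h5 (pentagonalSeries R) * (expand 5 h5 (pentagonalSeries R) *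
    (expand 5 h5 (pentagonalSeries R) * (expand 5 h5 (pentagonalSeries R) *
    expand 5 h5 (pentagonalSeries R))))) by ring]
  refine hl.unique (hr6.congr_fun fun n => ?_)
  simp only [← pow_mul]
  split_ifs with hd
  · obtain ⟨m, hm⟩ := hd
    have hone : ∀ i, w ^ (i * (n + 1)) = 1 := by
      intro i
      rw [hm, show i * (5 * m) = 5 * (i * m) by ring, pow_mul, hw, one_pow]
    simp only [hone, map_one]
    ring
  · have hs : 1 + w ^ (n + 1) + (w ^ (n + 1)) ^ 2 + (w ^ (n + 1)) ^ 3 + (w ^ (n + 1)) ^ 4 = 0 := by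
      have e : ∀ i, w ^ i = w ^ (i % 5) := fun i => pow_eq_pow_mod i hw
      rw [← pow_mul, ← pow_mul, ← pow_mul, e (n + 1), e ((n + 1) * 2), e ((n + 1) * 3),
        e ((n + 1) * 4), Nat.mul_mod _ 2, Nat.mul_mod _ 3, Nat.mul_mod _ 4]
      have : (n + 1) % 5 = 1 ∨ (n + 1) % 5 = 2 ∨ (n + 1) % 5 = 3 ∨ (n + 1) % 5 = 4 := by omega
      rcases this with h | h | h | h <;> rw [h] <;>
        norm_num <;> linear_combination hsum
    have hs' : 1 + C (w ^ (n + 1)) + C (w ^ (n + 1)) ^ 2 + C (w ^ (n + 1)) ^ 3 +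
        C (w ^ (n + 1)) ^ 4 = (0 : R⟦X⟧) := by
      simp only [← map_pow, ← map_one (C (R := R)), ← map_add, hs, map_zero]
    have h := prod_one_sub_pow_mul hs' (X ^ (n + 1) : R⟦X⟧)
    simp only [← map_pow, ← pow_mul] at h
    simp only [mul_zero, pow_zero, map_one, one_mul, mul_one, mul_comm _ (n + 1)] at h ⊢
    rw [h]

/-- The circulant norm of the three parts of Euler's product. -/
theorem circulant_norm {R : Type*} [CommRing R] {w a b c : R}
    (hsum : 1 + w + w ^ 2 + w ^ 3 + w ^ 4 = 0) (h : a * c = -b ^ 2) :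
    (a + b + c) * (a + w * b + w ^ 2 * c) * (a + w ^ 2 * b + w ^ 4 * c) *
      (a + w ^ 3 * b + w ^ 6 * c) * (a + w ^ 4 * b + w ^ 8 * c) = a ^ 5 + 11 * b ^ 5 + c ^ 5 := by
  have hw : w ^ 5 = 1 := by linear_combination (w - 1) * hsum
  have h1 : (a + w * b + w ^ 2 * c) * (a + w ^ 4 * b + w ^ 8 * c) =
      a ^ 2 + b ^ 2 + c ^ 2 + (w + w ^ 4) * (a * b + b * c) + (w ^ 2 + w ^ 3) * (a * c) := by
    linear_combination (b ^ 2 + w ^ 3 * a * c + (w ^ 4 + w) * b * c + (w ^ 5 + 1) * c ^ 2) * hw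
  have h2 : (a + w ^ 2 * b + w ^ 4 * c) * (a + w ^ 3 * b + w ^ 6 * c) =
      a ^ 2 + b ^ 2 + c ^ 2 + (w ^ 2 + w ^ 3) * (a * b + b * c) + (w + w ^ 4) * (a * c) := by
    linear_combination (b ^ 2 + w * a * c + (w ^ 3 + w ^ 2) * b * c + (w ^ 5 + 1) * c ^ 2) * hw
  have hst : (w + w ^ 4) + (w ^ 2 + w ^ 3) = -1 := by linear_combination hsum
  have hprod : (w + w ^ 4) * (w ^ 2 + w ^ 3) = -1 := by
    linear_combination hsum + (w + w ^ 2) * hw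
  have h3 : (a + b + c) * (a + w * b + w ^ 2 * c) * (a + w ^ 2 * b + w ^ 4 * c) *
      (a + w ^ 3 * b + w ^ 6 * c) * (a + w ^ 4 * b + w ^ 8 * c) = (a + b + c) *
      ((a + w * b + w ^ 2 * c) * (a + w ^ 4 * b + w ^ 8 * c)) *
      ((a + w ^ 2 * b + w ^ 4 * c) * (a + w ^ 3 * b + w ^ 6 * c)) := by ring
  rw [h3, h1, h2]
  generalize w + w ^ 4 = s at *
  generalize w ^ 2 + w ^ 3 = t at *
  have h4 : ∀ u v y : R, (u + s * v + t * y) * (u + t * v + s * y) =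
      u ^ 2 - u * (v + y) - (v ^ 2 + y ^ 2) + 3 * v * y := by
    intro u v y
    linear_combination (u * (v + y) + (s + t - 1) * v * y) * hst +
      (v ^ 2 + y ^ 2 - 2 * v * y) * hprod
  rw [mul_assoc, h4]
  linear_combination 5 * b * (a * c - 2 * b ^ 2) * h

theorem norm_pentagonalSeries (h5 : (5 : ℕ) ≠ 0) :
    (residuePart 0 (pentagonalSeries ℤ) ^ 5 + 11 * residuePart 1 (pentagonalSeries ℤ) ^ 5 +
      residuePart 2 (pentagonalSeries ℤ) ^ 5) * expand 5 h5 (expand 5 h5 (pentagonalSeries ℤ)) =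
    expand 5 h5 (pentagonalSeries ℤ) ^ 6 := by
  obtain ⟨w, hsum⟩ : ∃ w : ℂ, 1 + w + w ^ 2 + w ^ 3 + w ^ 4 = 0 := by
    have hp := Complex.isPrimitiveRoot_exp 5 h5
    have h := hp.geom_sum_eq_zero (by norm_num)
    simp only [Finset.sum_range_succ, Finset.sum_range_zero, pow_zero, pow_one, zero_add] at h
    exact ⟨_, h⟩
  have hw : w ^ 5 = 1 := by linear_combination (w - 1) * hsum
  have hinj : Function.Injective (PowerSeries.map (Int.castRingHom ℂ)) :=
    PowerSeries.map_injective _ Int.cast_injective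
  refine hinj ?_
  have hnorm := prod_rescale_pentagonalSeries hsum h5
  have hmap : ∀ f : ℤ⟦X⟧, PowerSeries.map (Int.castRingHom ℂ) (expand 5 h5 f) =
      expand 5 h5 (PowerSeries.map (Int.castRingHom ℂ) f) := fun f => map_expand _ _ _ _
  have hsupp : ∀ r f, SupportedMod r f → SupportedMod r (PowerSeries.map (Int.castRingHom ℂ) f) := by
    intro r f hf n hn
    rw [coeff_map, hf n hn, map_zero]
  have ha := hsupp _ _ (supportedMod_residuePart 0 (pentagonalSeries ℤ))
  have hb := hsupp _ _ (supportedMod_residuePart 1 (pentagonalSeries ℤ))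
  have hc := hsupp _ _ (supportedMod_residuePart 2 (pentagonalSeries ℤ))
  have hE := congrArg (PowerSeries.map (Int.castRingHom ℂ)) pentagonalSeries_eq_add_residueParts
  have hrel := congrArg (PowerSeries.map (Int.castRingHom ℂ)) residuePart_zero_mul_residuePart_two
  rw [map_pentagonalSeries] at hE
  simp only [map_add, map_mul, map_neg, map_pow, map_ofNat, hmap, map_pentagonalSeries] at hE hrel ⊢
  rw [← hnorm]
  congr 1
  generalize PowerSeries.map (Int.castRingHom ℂ) (residuePart 0 (pentagonalSeries ℤ)) = a at *
  generalize PowerSeries.map (Int.castRingHom ℂ) (residuePart 1 (pentagonalSeries ℤ)) = b at *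
  generalize PowerSeries.map (Int.castRingHom ℂ) (residuePart 2 (pentagonalSeries ℤ)) = c at *
  have hres : ∀ i : ℕ, rescale (w ^ i) (pentagonalSeries ℂ) =
      a + C w ^ i * b + C w ^ (2 * i) * c := by
    intro i
    have hwi : (w ^ i) ^ 5 = 1 := by rw [← pow_mul, mul_comm, pow_mul, hw, one_pow]
    rw [hE, map_add, map_add, rescale_of_supportedMod (r := 0) (by simpa using ha) hwi,
      rescale_of_supportedMod (r := 1) (by simpa using hb) hwi,
      rescale_of_supportedMod (r := 2) (by simpa using hc) hwi, map_pow]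
    ring
  have hsum' : 1 + C w + C w ^ 2 + C w ^ 3 + C w ^ 4 = (0 : ℂ⟦X⟧) := by
    simp only [← map_pow, ← map_one (C (R := ℂ)), ← map_add, hsum, map_zero]
  rw [hres, hres, hres, hres, hres, ← circulant_norm hsum' hrel]
  ring

/-- The substitution `X ↦ X ^ 5`. -/
noncomputable abbrev expandFive : ℤ⟦X⟧ →ₐ[ℤ] ℤ⟦X⟧ := expand 5 (by norm_num)

theorem expandFive_X : expandFive X = X ^ 5 := by
  rw [expandFive, expand_X]

/-- Extraction of the exponents divisible by `5`, as an operator on power series. -/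
noncomputable def sectFive : ℤ⟦X⟧ →ₗ[ℤ] ℤ⟦X⟧ where
  toFun f := .mk fun n => coeff (5 * n) f
  map_add' f g := by ext; simp
  map_smul' c f := by
    ext n
    rw [RingHom.id_apply, coeff_mk, map_zsmul, map_zsmul, coeff_mk]

@[simp]
theorem coeff_sectFive (f : ℤ⟦X⟧) (n : ℕ) : coeff n (sectFive f) = coeff (5 * n) f := by
  change coeff n (.mk fun n => coeff (5 * n) f) = _
  rw [coeff_mk]

theorem sectFive_mul_expandFive (f g : ℤ⟦X⟧) :
    sectFive (f * expandFive g) = sectFive f * g := by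
  ext n
  rw [coeff_sectFive, coeff_mul, coeff_mul]
  have hinj : Function.Injective fun x : ℕ × ℕ => (5 * x.1, 5 * x.2) := by
    rintro ⟨a, b⟩ ⟨c, d⟩ h
    simp only [Prod.mk.injEq] at h
    ext <;> simp only <;> omega
  symm
  refine Finset.sum_of_injOn _ hinj.injOn ?_ ?_ ?_
  · rintro ⟨a, b⟩ h
    simp only [Finset.mem_coe, Finset.HasAntidiagonal.mem_antidiagonal] at h ⊢
    omega
  · rintro ⟨a, b⟩ h hn
    simp only [Finset.HasAntidiagonal.mem_antidiagonal] at h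
    rw [coeff_expand, if_neg, mul_zero]
    rintro ⟨c, rfl⟩
    refine hn ⟨(a / 5, c), ?_, ?_⟩
    · simp only [Finset.mem_coe, Finset.HasAntidiagonal.mem_antidiagonal]
      omega
    · exact Prod.ext (by simp only at h ⊢; omega) rfl
  · rintro ⟨a, b⟩ -
    simp [coeff_expand]

theorem sectFive_one : sectFive 1 = 1 := by
  ext n
  simp [coeff_one]

theorem sectFive_expandFive (g : ℤ⟦X⟧) : sectFive (expandFive g) = g := by
  simpa [sectFive_one] using sectFive_mul_expandFive 1 g

theorem sectFive_ofNat_mul (n : ℕ) [n.AtLeastTwo] (f : ℤ⟦X⟧) :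
    sectFive (ofNat(n) * f) = ofNat(n) * sectFive f := by
  have h := sectFive_mul_expandFive f ofNat(n)
  rwa [map_ofNat, mul_comm, mul_comm (sectFive f)] at h

theorem sectFive_eq_zero {r : ZMod 5} {f : ℤ⟦X⟧} (hf : SupportedMod r f) (hr : r ≠ 0) :
    sectFive f = 0 := by
  ext n
  rw [coeff_sectFive, hf, map_zero]
  rw [Nat.cast_mul, show ((5 : ℕ) : ZMod 5) = 0 from rfl, zero_mul]
  exact hr.symm

theorem sectFive_monomial (e i j k : ℕ) (h : (e + j + 2 * k) % 5 ≠ 0) :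
    sectFive (X ^ e * (residuePart 0 (pentagonalSeries ℤ) ^ i *
      residuePart 1 (pentagonalSeries ℤ) ^ j * residuePart 2 (pentagonalSeries ℤ) ^ k)) = 0 := by
  refine sectFive_eq_zero ((supportedMod_X.pow e).mul
    ((((supportedMod_residuePart 0 _).pow i).mul ((supportedMod_residuePart 1 _).pow j)).mul
      ((supportedMod_residuePart 2 _).pow k))) fun h0 => h ?_
  rw [← Nat.dvd_iff_mod_eq_zero, ← ZMod.natCast_eq_zero_iff, ← h0]
  push_cast
  ring

/-- The coefficients of `f` at the exponents `5 n + s`, in terms of `sectFive`. -/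
theorem coeff_succ_sectFive_X_pow_mul (r s : ℕ) (h : r + s = 5) (f : ℤ⟦X⟧) (n : ℕ) :
    coeff (n + 1) (sectFive (X ^ r * f)) = coeff (5 * n + s) f := by
  rw [coeff_sectFive, show 5 * (n + 1) = 5 * n + s + r by omega, coeff_X_pow_mul]

theorem sectFive_X_pow_four_mul : sectFive (X ^ 4 * pentagonalSeries ℤ) =
    -(X * expandFive (pentagonalSeries ℤ)) := by
  have hE := pentagonalSeries_eq_add_residueParts
  have hb := residuePart_one_pentagonalSeries
  have hm := sectFive_monomial
  have key : X ^ 4 * pentagonalSeries ℤ =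
      X ^ 4 * (residuePart 0 (pentagonalSeries ℤ) ^ 1 *
        residuePart 1 (pentagonalSeries ℤ) ^ 0 * residuePart 2 (pentagonalSeries ℤ) ^ 0) +
      X ^ 4 * (residuePart 0 (pentagonalSeries ℤ) ^ 0 *
        residuePart 1 (pentagonalSeries ℤ) ^ 0 * residuePart 2 (pentagonalSeries ℤ) ^ 1) -
      expandFive (X * expandFive (pentagonalSeries ℤ)) := by
    rw [map_mul, expandFive_X]
    linear_combination X ^ 4 * hE + X ^ 4 * hb
  rw [key, map_sub, map_add, hm _ _ _ _ (by norm_num), hm _ _ _ _ (by norm_num),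
    sectFive_expandFive]
  ring

theorem sectFive_X_pow_three_mul : sectFive (X ^ 3 * pentagonalSeries ℤ ^ 2) =
    -(X * expandFive (pentagonalSeries ℤ) ^ 2) := by
  have hE := pentagonalSeries_eq_add_residueParts
  have hb := residuePart_one_pentagonalSeries
  have hac := residuePart_zero_mul_residuePart_two
  have hm := sectFive_monomial
  generalize residuePart 0 (pentagonalSeries ℤ) = a at *
  generalize residuePart 1 (pentagonalSeries ℤ) = b at *
  generalize residuePart 2 (pentagonalSeries ℤ) = c at *
  have key : X ^ 3 * pentagonalSeries ℤ ^ 2 =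
      X ^ 3 * (a ^ 2 * b ^ 0 * c ^ 0) + 2 * (X ^ 3 * (a ^ 1 * b ^ 1 * c ^ 0)) +
      2 * (X ^ 3 * (a ^ 0 * b ^ 1 * c ^ 1)) + X ^ 3 * (a ^ 0 * b ^ 0 * c ^ 2) -
      expandFive (X * expandFive (pentagonalSeries ℤ) ^ 2) := by
    have h2 : X ^ 3 * b ^ 2 = expandFive (X * expandFive (pentagonalSeries ℤ) ^ 2) := by
      rw [hb, map_mul, map_pow, expandFive_X]
      ring
    rw [← h2, hE]
    linear_combination 2 * X ^ 3 * hac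
  rw [key]
  simp only [map_sub, map_add, sectFive_ofNat_mul, sectFive_expandFive]
  rw [hm _ _ _ _ (by norm_num), hm _ _ _ _ (by norm_num), hm _ _ _ _ (by norm_num),
    hm _ _ _ _ (by norm_num)]
  ring

theorem sectFive_X_pow_two_mul : sectFive (X ^ 2 * pentagonalSeries ℤ ^ 3) =
    5 * (X * expandFive (pentagonalSeries ℤ) ^ 3) := by
  have hE := pentagonalSeries_eq_add_residueParts
  have hb := residuePart_one_pentagonalSeries
  have hac := residuePart_zero_mul_residuePart_two
  have hm := sectFive_monomial
  generalize residuePart 0 (pentagonalSeries ℤ) = a at *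
  generalize residuePart 1 (pentagonalSeries ℤ) = b at *
  generalize residuePart 2 (pentagonalSeries ℤ) = c at *
  have key : X ^ 2 * pentagonalSeries ℤ ^ 3 =
      X ^ 2 * (a ^ 3 * b ^ 0 * c ^ 0) + 3 * (X ^ 2 * (a ^ 2 * b ^ 1 * c ^ 0)) +
      3 * (X ^ 2 * (a ^ 1 * b ^ 2 * c ^ 0)) + 3 * (X ^ 2 * (a ^ 2 * b ^ 0 * c ^ 1)) +
      3 * (X ^ 2 * (a ^ 1 * b ^ 0 * c ^ 2)) + 3 * (X ^ 2 * (a ^ 0 * b ^ 2 * c ^ 1)) +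
      3 * (X ^ 2 * (a ^ 0 * b ^ 1 * c ^ 2)) + X ^ 2 * (a ^ 0 * b ^ 0 * c ^ 3) +
      5 * expandFive (X * expandFive (pentagonalSeries ℤ) ^ 3) := by
    have h2 : -(X ^ 2 * b ^ 3) = expandFive (X * expandFive (pentagonalSeries ℤ) ^ 3) := by
      rw [hb, map_mul, map_pow, expandFive_X]
      ring
    rw [← h2, hE]
    linear_combination 6 * X ^ 2 * b * hac
  rw [key]
  simp only [map_add, sectFive_ofNat_mul, sectFive_expandFive]
  rw [hm _ 3 0 0 (by norm_num), hm _ 2 1 0 (by norm_num), hm _ 1 2 0 (by norm_num),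
    hm _ 2 0 1 (by norm_num), hm _ 1 0 2 (by norm_num), hm _ 0 2 1 (by norm_num),
    hm _ 0 1 2 (by norm_num), hm _ 0 0 3 (by norm_num)]
  ring

theorem sectFive_X_mul : sectFive (X ^ 1 * pentagonalSeries ℤ ^ 4) =
    -(5 * (X * expandFive (pentagonalSeries ℤ) ^ 4)) := by
  have hE := pentagonalSeries_eq_add_residueParts
  have hb := residuePart_one_pentagonalSeries
  have hac := residuePart_zero_mul_residuePart_two
  have hm := sectFive_monomial
  generalize residuePart 0 (pentagonalSeries ℤ) = a at *
  generalize residuePart 1 (pentagonalSeries ℤ) = b at *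
  generalize residuePart 2 (pentagonalSeries ℤ) = c at *
  have key : X ^ 1 * pentagonalSeries ℤ ^ 4 =
      X ^ 1 * (a ^ 4 * b ^ 0 * c ^ 0) + 4 * (X ^ 1 * (a ^ 3 * b ^ 1 * c ^ 0)) +
      4 * (X ^ 1 * (a ^ 3 * b ^ 0 * c ^ 1)) + 6 * (X ^ 1 * (a ^ 2 * b ^ 2 * c ^ 0)) +
      4 * (X ^ 1 * (a ^ 1 * b ^ 3 * c ^ 0)) + 12 * (X ^ 1 * (a ^ 2 * b ^ 1 * c ^ 1)) +
      12 * (X ^ 1 * (a ^ 1 * b ^ 1 * c ^ 2)) + 4 * (X ^ 1 * (a ^ 0 * b ^ 3 * c ^ 1)) +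
      4 * (X ^ 1 * (a ^ 1 * b ^ 0 * c ^ 3)) + 6 * (X ^ 1 * (a ^ 0 * b ^ 2 * c ^ 2)) +
      4 * (X ^ 1 * (a ^ 0 * b ^ 1 * c ^ 3)) + X ^ 1 * (a ^ 0 * b ^ 0 * c ^ 4) -
      5 * expandFive (X * expandFive (pentagonalSeries ℤ) ^ 4) := by
    have h2 : X ^ 1 * b ^ 4 = expandFive (X * expandFive (pentagonalSeries ℤ) ^ 4) := by
      rw [hb, map_mul, map_pow, expandFive_X]
      ring
    rw [← h2, hE]
    linear_combination X * (12 * b ^ 2 + 6 * (a * c - b ^ 2)) * hac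
  rw [key]
  simp only [map_sub, map_add, sectFive_ofNat_mul, sectFive_expandFive]
  rw [hm _ 4 0 0 (by norm_num), hm _ 3 1 0 (by norm_num), hm _ 3 0 1 (by norm_num),
    hm _ 2 2 0 (by norm_num), hm _ 1 3 0 (by norm_num), hm _ 2 1 1 (by norm_num),
    hm _ 1 1 2 (by norm_num), hm _ 0 3 1 (by norm_num), hm _ 1 0 3 (by norm_num),
    hm _ 0 2 2 (by norm_num), hm _ 0 1 3 (by norm_num), hm _ 0 0 4 (by norm_num)]
  ring

/-- The relation of degree five between Euler's product and its dilation by `25`. -/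
theorem quintic_relation :
    expandFive (expandFive (pentagonalSeries ℤ)) * (pentagonalSeries ℤ ^ 5 +
      5 * pentagonalSeries ℤ ^ 4 * (X * expandFive (expandFive (pentagonalSeries ℤ))) +
      15 * pentagonalSeries ℤ ^ 3 * (X * expandFive (expandFive (pentagonalSeries ℤ))) ^ 2 +
      25 * pentagonalSeries ℤ ^ 2 * (X * expandFive (expandFive (pentagonalSeries ℤ))) ^ 3 +
      25 * pentagonalSeries ℤ * (X * expandFive (expandFive (pentagonalSeries ℤ))) ^ 4) *
      expandFive partitionSeries ^ 6 = 1 := by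
  have hE := pentagonalSeries_eq_add_residueParts
  have hb := residuePart_one_pentagonalSeries
  have hac := residuePart_zero_mul_residuePart_two
  have hN := norm_pentagonalSeries (by norm_num)
  have hQ : (expandFive partitionSeries * expandFive (pentagonalSeries ℤ)) ^ 6 = 1 := by
    rw [← map_mul, partitionSeries_mul, map_one, one_pow]
  rw [← expandFive] at hN
  have hY : X * expandFive (expandFive (pentagonalSeries ℤ)) =
      -residuePart 1 (pentagonalSeries ℤ) := by rw [hb, neg_neg]
  rw [hY]
  generalize residuePart 0 (pentagonalSeries ℤ) = a at *
  generalize residuePart 1 (pentagonalSeries ℤ) = b at *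
  generalize residuePart 2 (pentagonalSeries ℤ) = c at *
  generalize expandFive (expandFive (pentagonalSeries ℤ)) = d at *
  generalize expandFive (pentagonalSeries ℤ) = e at *
  generalize expandFive partitionSeries = q at *
  rw [mul_pow] at hQ
  rw [← hQ, ← hN, hE]
  linear_combination (-d * q ^ 6 * (-5 * (a + c) ^ 3 + 5 * (a + c) * (a * c - b ^ 2))) * hac

/-- The power series `η(25τ) / η(τ)`. -/
noncomputable def etaQuotientTwentyFive : ℤ⟦X⟧ :=
  X * partitionSeries * expandFive (expandFive (pentagonalSeries ℤ))

/-- The power series `(η(5τ) / η(τ)) ^ 6`. -/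
noncomputable def etaQuotientFive : ℤ⟦X⟧ :=
  X * expandFive (pentagonalSeries ℤ) ^ 6 * partitionSeries ^ 6

theorem expandFive_etaQuotientFive : expandFive etaQuotientFive =
    X ^ 5 * expandFive (expandFive (pentagonalSeries ℤ)) ^ 6 * expandFive partitionSeries ^ 6 := by
  rw [etaQuotientFive, map_mul, map_mul, map_pow, map_pow, expandFive_X]

theorem expandFive_partitionSeries_mul :
    expandFive partitionSeries * expandFive (pentagonalSeries ℤ) = 1 := by
  rw [← map_mul, partitionSeries_mul, map_one]

theorem etaQuotientFive_ne_zero : etaQuotientFive ≠ 0 := by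
  refine mul_ne_zero (mul_ne_zero X_ne_zero (pow_ne_zero _ ?_)) (pow_ne_zero _ ?_)
  · exact right_ne_zero_of_mul_eq_one expandFive_partitionSeries_mul
  · exact left_ne_zero_of_mul_eq_one partitionSeries_mul

theorem etaQuotientFive_pow_mul_sectFive (j : ℕ) (f : ℤ⟦X⟧) :
    etaQuotientFive ^ j * sectFive f = sectFive (f * expandFive etaQuotientFive ^ j) := by
  rw [← map_pow, sectFive_mul_expandFive, mul_comm]

local notation "𝐳" => etaQuotientTwentyFive
local notation "𝐭" => etaQuotientFive

/-- The modular equation of degree five. -/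
theorem modular_equation : 𝐳 ^ 5 =
    expandFive 𝐭 * (25 * 𝐳 ^ 4 + 25 * 𝐳 ^ 3 + 15 * 𝐳 ^ 2 + 5 * 𝐳 + 1) := by
  have hM := quintic_relation
  have h1 := partitionSeries_mul
  rw [expandFive_etaQuotientFive, etaQuotientTwentyFive]
  generalize expandFive (expandFive (pentagonalSeries ℤ)) = d at *
  generalize expandFive partitionSeries = q at *
  generalize pentagonalSeries ℤ = e at *
  generalize partitionSeries = p at *
  have h2 : p ^ 2 * e ^ 2 = 1 := by rw [← mul_pow, h1, one_pow]
  have h3 : p ^ 3 * e ^ 3 = 1 := by rw [← mul_pow, h1, one_pow]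
  have h4 : p ^ 4 * e ^ 4 = 1 := by rw [← mul_pow, h1, one_pow]
  have h5 : p ^ 5 * e ^ 5 = 1 := by rw [← mul_pow, h1, one_pow]
  linear_combination -(X * p * d) ^ 5 * hM + X ^ 5 * d ^ 6 * q ^ 6 *
    (h5 + 5 * p * X * d * h4 + 15 * p ^ 2 * X ^ 2 * d ^ 2 * h3 +
      25 * p ^ 3 * X ^ 3 * d ^ 3 * h2 + 25 * p ^ 4 * X ^ 4 * d ^ 4 * h1)

theorem sectFive_pow_add_five (n : ℕ) : sectFive (𝐳 ^ (n + 5)) =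
    𝐭 * (25 * sectFive (𝐳 ^ (n + 4)) + 25 * sectFive (𝐳 ^ (n + 3)) +
      15 * sectFive (𝐳 ^ (n + 2)) + 5 * sectFive (𝐳 ^ (n + 1)) + sectFive (𝐳 ^ n)) := by
  have h : 𝐳 ^ (n + 5) = (25 * 𝐳 ^ (n + 4) + 25 * 𝐳 ^ (n + 3) + 15 * 𝐳 ^ (n + 2) +
      5 * 𝐳 ^ (n + 1) + 𝐳 ^ n) * expandFive 𝐭 := by
    linear_combination 𝐳 ^ n * modular_equation
  rw [h, sectFive_mul_expandFive]
  simp only [map_add, sectFive_ofNat_mul]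
  ring

/-- The low powers of `𝐳`, written for the evaluation of `sectFive` on them. -/
theorem etaQuotientTwentyFive_pow_eq :
    𝐳 = 25 * expandFive 𝐭 + (25 * (X ^ 4 * pentagonalSeries ℤ)) *
        expandFive (expandFive (pentagonalSeries ℤ) ^ 5 * partitionSeries ^ 6) +
      (15 * (X ^ 3 * pentagonalSeries ℤ ^ 2)) *
        expandFive (expandFive (pentagonalSeries ℤ) ^ 4 * partitionSeries ^ 6) +
      (5 * (X ^ 2 * pentagonalSeries ℤ ^ 3)) *
        expandFive (expandFive (pentagonalSeries ℤ) ^ 3 * partitionSeries ^ 6) +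
      (X ^ 1 * pentagonalSeries ℤ ^ 4) *
        expandFive (expandFive (pentagonalSeries ℤ) ^ 2 * partitionSeries ^ 6) ∧
    𝐳 ^ 2 = (25 * 𝐳 + 25) * expandFive 𝐭 + (15 * (X ^ 4 * pentagonalSeries ℤ)) *
        expandFive (expandFive (pentagonalSeries ℤ) ^ 5 * partitionSeries ^ 6) +
      (5 * (X ^ 3 * pentagonalSeries ℤ ^ 2)) *
        expandFive (expandFive (pentagonalSeries ℤ) ^ 4 * partitionSeries ^ 6) +
      (X ^ 2 * pentagonalSeries ℤ ^ 3) *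
        expandFive (expandFive (pentagonalSeries ℤ) ^ 3 * partitionSeries ^ 6) ∧
    𝐳 ^ 3 = (25 * 𝐳 ^ 2 + 25 * 𝐳 + 15) * expandFive 𝐭 + (5 * (X ^ 4 * pentagonalSeries ℤ)) *
        expandFive (expandFive (pentagonalSeries ℤ) ^ 5 * partitionSeries ^ 6) +
      (X ^ 3 * pentagonalSeries ℤ ^ 2) *
        expandFive (expandFive (pentagonalSeries ℤ) ^ 4 * partitionSeries ^ 6) ∧
    𝐳 ^ 4 = (25 * 𝐳 ^ 3 + 25 * 𝐳 ^ 2 + 15 * 𝐳 + 5) * expandFive 𝐭 +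
      (X ^ 4 * pentagonalSeries ℤ) *
        expandFive (expandFive (pentagonalSeries ℤ) ^ 5 * partitionSeries ^ 6) := by
  have hM := quintic_relation
  have h1 := partitionSeries_mul
  simp only [expandFive_etaQuotientFive, etaQuotientTwentyFive, map_mul, map_pow]
  generalize expandFive (expandFive (pentagonalSeries ℤ)) = d at *
  generalize expandFive partitionSeries = q at *
  generalize pentagonalSeries ℤ = e at *
  generalize partitionSeries = p at *
  have h2 : p ^ 2 * e ^ 2 = 1 := by rw [← mul_pow, h1, one_pow]
  have h3 : p ^ 3 * e ^ 3 = 1 := by rw [← mul_pow, h1, one_pow]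
  have h4 : p ^ 4 * e ^ 4 = 1 := by rw [← mul_pow, h1, one_pow]
  refine ⟨?_, ?_, ?_, ?_⟩
  · linear_combination -(X * p * d) * hM + X * d ^ 2 * q ^ 6 *
      (e ^ 4 + 5 * e ^ 3 * (X * d) + 15 * e ^ 2 * (X * d) ^ 2 + 25 * e * (X * d) ^ 3 +
        25 * (X * d) ^ 4) * h1
  · linear_combination -(X * p * d) ^ 2 * hM + X ^ 2 * d ^ 3 * q ^ 6 *
      ((e ^ 3 + 5 * e ^ 2 * (X * d) + 15 * e * (X * d) ^ 2 + 25 * (X * d) ^ 3) * h2 +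
        25 * p * (X * d) ^ 4 * h1)
  · linear_combination -(X * p * d) ^ 3 * hM + X ^ 3 * d ^ 4 * q ^ 6 *
      ((e ^ 2 + 5 * e * (X * d) + 15 * (X * d) ^ 2) * h3 + 25 * p * (X * d) ^ 3 * h2 +
        25 * p ^ 2 * (X * d) ^ 4 * h1)
  · linear_combination -(X * p * d) ^ 4 * hM + X ^ 4 * d ^ 5 * q ^ 6 *
      ((e + 5 * (X * d)) * h4 + 15 * p * (X * d) ^ 2 * h3 + 25 * p ^ 2 * (X * d) ^ 3 * h2 +
        25 * p ^ 3 * (X * d) ^ 4 * h1)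

theorem sectFive_pow_one : sectFive (𝐳 ^ 1) = 5 * 𝐭 := by
  rw [pow_one, etaQuotientTwentyFive_pow_eq.1]
  simp only [map_add, sectFive_mul_expandFive, sectFive_ofNat_mul, sectFive_expandFive,
    sectFive_X_pow_four_mul, sectFive_X_pow_three_mul, sectFive_X_pow_two_mul, sectFive_X_mul, etaQuotientFive]
  ring

theorem sectFive_pow_two : sectFive (𝐳 ^ 2) = 10 * 𝐭 + 125 * 𝐭 ^ 2 := by
  have h1 := sectFive_pow_one
  have h0 := sectFive_ofNat_mul 25 1
  rw [pow_one] at h1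
  rw [mul_one] at h0
  rw [etaQuotientTwentyFive_pow_eq.2.1]
  simp only [map_add, sectFive_mul_expandFive, sectFive_ofNat_mul, h0, h1, sectFive_one,
    sectFive_X_pow_four_mul, sectFive_X_pow_three_mul, sectFive_X_pow_two_mul]
  simp only [etaQuotientFive]
  ring

theorem sectFive_pow_three : sectFive (𝐳 ^ 3) = 9 * 𝐭 + 375 * 𝐭 ^ 2 + 3125 * 𝐭 ^ 3 := by
  have h1 := sectFive_pow_one
  have h0 := sectFive_ofNat_mul 15 1
  rw [pow_one] at h1
  rw [mul_one] at h0
  rw [etaQuotientTwentyFive_pow_eq.2.2.1]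
  simp only [map_add, sectFive_mul_expandFive, sectFive_ofNat_mul, h0, h1, sectFive_pow_two,
    sectFive_one, sectFive_X_pow_four_mul, sectFive_X_pow_three_mul]
  simp only [etaQuotientFive]
  ring

theorem sectFive_pow_four : sectFive (𝐳 ^ 4) =
    4 * 𝐭 + 550 * 𝐭 ^ 2 + 12500 * 𝐭 ^ 3 + 78125 * 𝐭 ^ 4 := by
  have h1 := sectFive_pow_one
  have h0 := sectFive_ofNat_mul 5 1
  rw [pow_one] at h1
  rw [mul_one] at h0
  rw [etaQuotientTwentyFive_pow_eq.2.2.2]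
  simp only [map_add, sectFive_mul_expandFive, sectFive_ofNat_mul, h0, h1, sectFive_pow_two,
    sectFive_pow_three, sectFive_one, sectFive_X_pow_four_mul]
  simp only [etaQuotientFive]
  ring

/-- The span of the multiples `5 ^ e i • 𝐭 ^ i` with `p i`. -/
noncomputable def weightedSpan (p : ℕ → Prop) (e : ℕ → ℕ) : Submodule ℤ ℤ⟦X⟧ :=
  Submodule.span ℤ {f | ∃ i, p i ∧ f = (5 ^ e i : ℤ) • 𝐭 ^ i}

theorem smul_pow_mem_weightedSpan {p : ℕ → Prop} {e : ℕ → ℕ} {i k : ℕ} (hp : p i) (h : e i ≤ k) :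
    (5 ^ k : ℤ) • 𝐭 ^ i ∈ weightedSpan p e := by
  obtain ⟨d, rfl⟩ := Nat.exists_eq_add_of_le' h
  rw [pow_add, mul_smul]
  exact Submodule.smul_mem _ _ (Submodule.subset_span ⟨i, hp, rfl⟩)

theorem map_mem_of_mem_weightedSpan {p : ℕ → Prop} {e : ℕ → ℕ} {M : Submodule ℤ ℤ⟦X⟧}
    (L : ℤ⟦X⟧ →ₗ[ℤ] ℤ⟦X⟧) (h : ∀ i, p i → (5 ^ e i : ℤ) • L (𝐭 ^ i) ∈ M) {f : ℤ⟦X⟧}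
    (hf : f ∈ weightedSpan p e) : L f ∈ M := by
  have : weightedSpan p e ≤ M.comap L := by
    refine Submodule.span_le.2 ?_
    rintro _ ⟨i, hi, rfl⟩
    rw [SetLike.mem_coe, Submodule.mem_comap, map_smul]
    exact h i hi
  exact this hf

theorem sectFive_pow_mem (n : ℕ) : sectFive (𝐳 ^ n) ∈
    weightedSpan (fun i => n ≤ 5 * i) fun i => (5 * i - n - 1) / 2 := by
  induction n using Nat.strong_induction_on with
  | _ n ih =>
  have hmem : ∀ i k : ℕ, ∀ c : ℤ, n ≤ 5 * i → (5 * i - n - 1) / 2 ≤ k →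
      c • (5 ^ k : ℤ) • 𝐭 ^ i ∈
        weightedSpan (fun i => n ≤ 5 * i) fun i => (5 * i - n - 1) / 2 :=
    fun i k c hi hk => Submodule.smul_mem _ _ (smul_pow_mem_weightedSpan hi hk)
  match n, ih, hmem with
  | 0, _, hmem =>
    have := hmem 0 0 1 (by omega) (by omega)
    simpa [sectFive_one] using this
  | 1, _, hmem =>
    rw [sectFive_pow_one]
    convert hmem 1 1 1 (by omega) (by omega) using 1
    simp only [zsmul_eq_mul]
    push_cast
    ring
  | 2, _, hmem =>
    rw [sectFive_pow_two]
    convert add_mem (hmem 1 1 2 (by omega) (by omega)) (hmem 2 3 1 (by omega) (by omega)) using 1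
    simp only [zsmul_eq_mul]
    push_cast
    ring
  | 3, _, hmem =>
    rw [sectFive_pow_three]
    convert add_mem (add_mem (hmem 1 0 9 (by omega) (by omega))
      (hmem 2 3 3 (by omega) (by omega))) (hmem 3 5 1 (by omega) (by omega)) using 1
    simp only [zsmul_eq_mul]
    push_cast
    ring
  | 4, _, hmem =>
    rw [sectFive_pow_four]
    convert add_mem (add_mem (add_mem (hmem 1 0 4 (by omega) (by omega))
      (hmem 2 2 22 (by omega) (by omega))) (hmem 3 5 4 (by omega) (by omega)))
      (hmem 4 7 1 (by omega) (by omega)) using 1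
    simp only [zsmul_eq_mul]
    push_cast
    ring
  | n + 5, ih, _ =>
    have step : ∀ (m v : ℕ) (c : ℤ), m ≤ 4 → m ≤ 2 * v →
        c • (5 ^ v : ℤ) • (𝐭 * sectFive (𝐳 ^ (n + m))) ∈
          weightedSpan (fun i => n + 5 ≤ 5 * i) fun i => (5 * i - (n + 5) - 1) / 2 := by
      intro m v c hm hv
      refine Submodule.smul_mem _ _ ?_
      refine map_mem_of_mem_weightedSpan ((5 ^ v : ℤ) • LinearMap.mulLeft ℤ 𝐭) ?_
        (ih (n + m) (by omega))
      intro i hi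
      rw [LinearMap.smul_apply, LinearMap.mulLeft_apply, ← pow_succ', smul_smul, ← pow_add]
      exact smul_pow_mem_weightedSpan (by omega) (by omega)
    rw [sectFive_pow_add_five]
    convert add_mem (add_mem (add_mem (add_mem (step 4 2 1 (by omega) (by omega))
      (step 3 2 1 (by omega) (by omega))) (step 2 1 3 (by omega) (by omega)))
      (step 1 1 1 (by omega) (by omega))) (step 0 0 1 (by omega) (by omega)) using 1
    simp only [zsmul_eq_mul, add_zero]
    push_cast
    ring

/-- The operator on power series in `(η(5τ) / η(τ)) ^ 6` that describes the dissection of a series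
multiplied by the `r`-th power of the partition generating function. -/
noncomputable def sectOperator (r : ℕ) : ℤ⟦X⟧ →ₗ[ℤ] ℤ⟦X⟧ :=
  LinearMap.mulLeft ℤ (expandFive (pentagonalSeries ℤ) ^ r) ∘ₗ sectFive ∘ₗ
    LinearMap.mulLeft ℤ (X ^ r * partitionSeries ^ r)

theorem sectOperator_apply (r : ℕ) (f : ℤ⟦X⟧) : sectOperator r f =
    expandFive (pentagonalSeries ℤ) ^ r * sectFive (X ^ r * partitionSeries ^ r * f) := rfl

theorem sectFive_eq_mul_sectOperator (r : ℕ) (f : ℤ⟦X⟧) :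
    sectFive (X ^ r * partitionSeries ^ r * f) =
      expandFive partitionSeries ^ r * sectOperator r f := by
  rw [sectOperator_apply, ← mul_assoc, ← mul_pow (expandFive partitionSeries),
    expandFive_partitionSeries_mul, one_pow, one_mul]

theorem pow_mul_sectOperator_pow (r j : ℕ) :
    𝐭 ^ j * sectOperator r (𝐭 ^ j) = sectFive (𝐳 ^ (6 * j + r)) := by
  have h1 : 𝐭 * expandFive 𝐭 = 𝐳 ^ 6 := by
    have h := expandFive_partitionSeries_mul
    rw [expandFive_etaQuotientFive, etaQuotientFive, etaQuotientTwentyFive]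
    have h6 : expandFive partitionSeries ^ 6 * expandFive (pentagonalSeries ℤ) ^ 6 = 1 := by
      rw [← mul_pow, h, one_pow]
    linear_combination X ^ 6 * partitionSeries ^ 6 *
      expandFive (expandFive (pentagonalSeries ℤ)) ^ 6 * h6
  rw [sectOperator_apply, mul_left_comm, etaQuotientFive_pow_mul_sectFive, mul_comm,
    ← sectFive_mul_expandFive, pow_add, pow_mul, ← h1, map_pow]
  congr 1
  rw [etaQuotientTwentyFive, mul_pow, mul_pow, mul_pow]
  ring

theorem sectOperator_pow_mem (r j : ℕ) : sectOperator r (𝐭 ^ j) ∈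
    weightedSpan (fun i => j + r ≤ 5 * i) fun i => (5 * i - (j + r) - 1) / 2 := by
  have h : sectFive (𝐳 ^ (6 * j + r)) ∈
      (weightedSpan (fun i => j + r ≤ 5 * i) fun i => (5 * i - (j + r) - 1) / 2).map
        (LinearMap.mulLeft ℤ (𝐭 ^ j)) := by
    refine map_mem_of_mem_weightedSpan LinearMap.id ?_ (sectFive_pow_mem (6 * j + r))
    intro i hi
    refine ⟨_, smul_pow_mem_weightedSpan (i := i - j) (k := (5 * i - (6 * j + r) - 1) / 2)
      (by omega) (by omega), ?_⟩
    rw [map_smul, LinearMap.mulLeft_apply, ← pow_add, Nat.add_sub_cancel' (by omega)]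
    rfl
  obtain ⟨w, hw, he⟩ := h
  rw [← pow_mul_sectOperator_pow, LinearMap.mulLeft_apply] at he
  rwa [← mul_left_cancel₀ (pow_ne_zero j etaQuotientFive_ne_zero) he]

theorem level_exponent_le {A i j : ℕ} (hi : 1 ≤ i) (hj : 1 ≤ j) :
    A + 1 + (5 * i - 4) / 2 ≤ A + (5 * j - 5) / 2 + (5 * i - (j + 0) - 1) / 2 := by
  obtain rfl | hj := hj.eq_or_lt <;> omega

/-- The span of the multiples `5 ^ (A + (5 * j - B) / 2) • 𝐭 ^ j` for `j ≥ 1`. -/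
noncomputable abbrev levelSpan (A B : ℕ) : Submodule ℤ ℤ⟦X⟧ :=
  weightedSpan (fun j => 1 ≤ j) fun j => A + (5 * j - B) / 2

theorem sectOperator_mem_levelSpan {r A B A' B' : ℕ}
    (h : ∀ i j, 1 ≤ i → 1 ≤ j → j + r ≤ 5 * i →
      A' + (5 * i - B') / 2 ≤ A + (5 * j - B) / 2 + (5 * i - (j + r) - 1) / 2)
    {f : ℤ⟦X⟧} (hf : f ∈ levelSpan A B) : sectOperator r f ∈ levelSpan A' B' := by
  refine map_mem_of_mem_weightedSpan _ (fun j hj => ?_) hf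
  refine map_mem_of_mem_weightedSpan ((5 ^ (A + (5 * j - B) / 2) : ℤ) • LinearMap.id) ?_
    (sectOperator_pow_mem r j)
  intro i hi
  rw [LinearMap.smul_apply, LinearMap.id_apply, smul_smul, mul_comm, ← pow_add]
  exact smul_pow_mem_weightedSpan (by omega) (h i j (by omega) hj hi)

theorem dvd_coeff_of_mem_levelSpan {A B : ℕ} {f : ℤ⟦X⟧} (hf : f ∈ levelSpan A B) (g : ℤ⟦X⟧)
    (n : ℕ) : (5 ^ A : ℤ) ∣ coeff n (g * f) := by
  have h := map_mem_of_mem_weightedSpan (M := LinearMap.range ((5 ^ A : ℤ) • LinearMap.id))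
    LinearMap.id (fun i _ => ?_) hf
  · obtain ⟨u, hu⟩ := h
    rw [LinearMap.id_apply] at hu
    rw [← hu, LinearMap.smul_apply, LinearMap.id_apply, mul_smul_comm, map_zsmul, smul_eq_mul]
    exact dvd_mul_right _ _
  · refine ⟨(5 ^ ((5 * i - B) / 2) : ℤ) • 𝐭 ^ i, ?_⟩
    rw [LinearMap.smul_apply, LinearMap.id_apply, LinearMap.id_apply, smul_smul, ← pow_add]

/-- The series whose coefficients are those of `f` at the exponents `5 n + s`. -/
noncomputable def residueSect (s : ℕ) (f : ℤ⟦X⟧) : ℤ⟦X⟧ := .mk fun n => coeff (5 * n + s) f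

theorem X_mul_residueSect {r s : ℕ} (hr : r ≠ 0) (h : r + s = 5) (f : ℤ⟦X⟧) :
    X * residueSect s f = sectFive (X ^ r * f) := by
  ext n
  rcases n with _ | n
  · rw [coeff_sectFive, coeff_zero_X_mul, mul_zero, coeff_X_pow_mul', if_neg (by omega)]
  · rw [coeff_succ_X_mul, coeff_succ_sectFive_X_pow_mul r s h, residueSect, coeff_mk]

theorem coeff_residueSect_mul {r s : ℕ} (hr : r ≠ 0) (h : r + s = 5) (f g : ℤ⟦X⟧) (n : ℕ) :
    coeff n (residueSect s f * g) = coeff (5 * n + s) (f * expandFive g) := by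
  rw [← coeff_succ_X_mul, ← mul_assoc, X_mul_residueSect hr h, ← sectFive_mul_expandFive,
    mul_assoc, coeff_succ_sectFive_X_pow_mul r s h]

theorem expand_expandFive {p q : ℕ} (hp : p ≠ 0) (hq : q ≠ 0) (h : q = p * 5) (g : ℤ⟦X⟧) :
    expand p hp (expandFive g) = expand q hq g := by
  subst h
  exact (expand_mul _ _ _ _ _).symm

/-- Iterated dissection of the generating function of the partition numbers. -/
theorem exists_sect_partitionSeries (m : ℕ) : ∃ (A f : ℤ⟦X⟧) (o : ℕ),
    24 * o = 23 * 25 ^ (m + 1) + 1 ∧ f ∈ levelSpan (2 * (m + 1)) 4 ∧ X * A = partitionSeries * f ∧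
    ∀ g n, coeff n (A * g) = coeff (5 ^ (2 * (m + 1)) * n + o)
      (partitionSeries * expand (5 ^ (2 * (m + 1))) (by positivity) g) := by
  induction m with
  | zero =>
    have ht : (5 : ℤ) • 𝐭 ∈ levelSpan 1 5 := by
      have := smul_pow_mem_weightedSpan (p := fun j => 1 ≤ j)
        (e := fun j => 1 + (5 * j - 5) / 2) (i := 1) (k := 1) le_rfl le_rfl
      rwa [pow_one, pow_one] at this
    have h1 : sectFive (X ^ 1 * partitionSeries) = expandFive partitionSeries * (5 : ℤ) • 𝐭 := by
      have h := sectFive_pow_one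
      rw [pow_one, etaQuotientTwentyFive, sectFive_mul_expandFive] at h
      rw [zsmul_eq_mul, pow_one]
      push_cast
      linear_combination expandFive partitionSeries * h -
        sectFive (X * partitionSeries) * expandFive_partitionSeries_mul
    refine ⟨residueSect 4 (residueSect 4 partitionSeries), sectOperator 0 ((5 : ℤ) • 𝐭), 24,
      by norm_num, sectOperator_mem_levelSpan (fun _ _ hi hj _ => level_exponent_le hi hj) ht, ?_, ?_⟩
    · have h0 := sectFive_eq_mul_sectOperator 0 ((5 : ℤ) • 𝐭)
      simp only [pow_zero, one_mul] at h0
      rw [X_mul_residueSect one_ne_zero rfl, pow_one, X_mul_residueSect one_ne_zero rfl, h1,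
        mul_comm, sectFive_mul_expandFive, mul_comm, h0]
    · intro g n
      rw [coeff_residueSect_mul one_ne_zero rfl, coeff_residueSect_mul one_ne_zero rfl,
        ← expand_mul]
      congr 2
      omega
  | succ m ih =>
    obtain ⟨A, f, o, ho, hf, hA, hc⟩ := ih
    have hf1 : sectOperator 1 f ∈ levelSpan (2 * (m + 1) + 1) 5 :=
      sectOperator_mem_levelSpan (by omega) hf
    refine ⟨residueSect 4 (residueSect 3 A), sectOperator 0 (sectOperator 1 f),
      5 ^ (2 * (m + 1)) * 23 + o, ?_, sectOperator_mem_levelSpan (fun _ _ hi hj _ => level_exponent_le hi hj) hf1, ?_, ?_⟩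
    · rw [pow_mul, pow_succ 25 (m + 1)]
      norm_num
      omega
    · have h1 : sectFive (X ^ 2 * A) = expandFive partitionSeries * sectOperator 1 f := by
        rw [pow_two, mul_assoc, hA]
        have := sectFive_eq_mul_sectOperator 1 f
        rwa [pow_one, pow_one, pow_one, mul_assoc] at this
      have h0 := sectFive_eq_mul_sectOperator 0 (sectOperator 1 f)
      simp only [pow_zero, one_mul] at h0
      rw [X_mul_residueSect one_ne_zero rfl, pow_one, X_mul_residueSect two_ne_zero rfl, h1,
        mul_comm, sectFive_mul_expandFive, mul_comm, h0]
    · intro g n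
      rw [coeff_residueSect_mul one_ne_zero rfl, coeff_residueSect_mul two_ne_zero rfl, hc,
        expand_expandFive (q := 5 ^ (2 * (m + 1)) * 5) _ (by positivity) rfl,
        expand_expandFive (q := 5 ^ (2 * (m + 1 + 1))) _ (by positivity) (by ring)]
      congr 2
      ring

/-- Dissection of a series that is a multiple of the square of the partition generating function. -/
theorem exists_sect_of_eq_sq_mul {F f : ℤ⟦X⟧} {N : ℕ} (hf : f ∈ levelSpan N 4)
    (hF : X * F = partitionSeries ^ 2 * f) (β : ℕ) : ∃ (G g : ℤ⟦X⟧) (o : ℕ),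
    24 * o + 22 = 22 * 25 ^ β ∧ g ∈ levelSpan (N + β) 4 ∧ X * G = partitionSeries ^ 2 * g ∧
    ∀ n, coeff n G = coeff (25 ^ β * n + o) F := by
  induction β with
  | zero => exact ⟨F, f, 0, by norm_num, hf, hF, fun n => by simp⟩
  | succ β ih =>
    obtain ⟨G, g, o, ho, hg, hG, hc⟩ := ih
    have hg2 : sectOperator 2 g ∈ levelSpan (N + β) 4 :=
      sectOperator_mem_levelSpan (by omega) hg
    refine ⟨residueSect 4 (residueSect 2 G), sectOperator 0 (sectOperator 2 g),
      25 ^ β * 22 + o, ?_, sectOperator_mem_levelSpan (by omega) hg2, ?_, ?_⟩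
    · rw [pow_succ]
      omega
    · have h1 : sectFive (X ^ 3 * G) = expandFive partitionSeries ^ 2 * sectOperator 2 g := by
        rw [pow_succ, mul_assoc, hG, ← sectFive_eq_mul_sectOperator, mul_assoc]
      have h0 := sectFive_eq_mul_sectOperator 0 (sectOperator 2 g)
      simp only [pow_zero, one_mul] at h0
      rw [X_mul_residueSect one_ne_zero rfl, pow_one, X_mul_residueSect three_ne_zero rfl, h1,
        mul_comm, ← map_pow, sectFive_mul_expandFive, mul_comm, h0]
    · intro n
      rw [residueSect, coeff_mk, residueSect, coeff_mk, hc]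
      congr 2
      ring

end Dissection
end TwoColorPartition

/-- For all `n, β ≥ 0` and `k ≥ 1`, `24` divides `22·5^{2k+2β+2} + 5^{2k} + 1` and
`p_{1,5^{2k}}(5^{2k+2β+2} n + (22·5^{2k+2β+2} + 5^{2k} + 1)/24) ≡ 0 (mod 5^{2k+β+1})`. -/
theorem twoColorCongruence_even_c (n β k : ℕ) (hk : 1 ≤ k) :
    24 ∣ 22 * 5 ^ (2 * k + 2 * β + 2) + 5 ^ (2 * k) + 1 ∧
      5 ^ (2 * k + β + 1) ∣
        p1 (5 ^ (2 * k))
          (5 ^ (2 * k + 2 * β + 2) * n +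
            (22 * 5 ^ (2 * k + 2 * β + 2) + 5 ^ (2 * k) + 1) / 24) := by
  obtain ⟨m, rfl⟩ := Nat.exists_eq_add_of_le' hk
  obtain ⟨A, f, o, ho, hf, hA, hc⟩ := TwoColorPartition.exists_sect_partitionSeries m
  have hF : X * (A * TwoColorPartition.partitionSeries) =
      TwoColorPartition.partitionSeries ^ 2 * f := by
    linear_combination TwoColorPartition.partitionSeries * hA
  obtain ⟨G, g, o', ho', hg, hG, hc'⟩ := TwoColorPartition.exists_sect_of_eq_sq_mul hf hF (β + 1)
  have hpow : 5 ^ (2 * (m + 1) + 2 * β + 2) = 5 ^ (2 * (m + 1)) * 25 ^ (β + 1) := by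
    rw [show 2 * (m + 1) + 2 * β + 2 = 2 * (m + 1) + 2 * (β + 1) by ring, pow_add,
      pow_mul 5 2 (β + 1)]
    norm_num
  have hoff : 22 * 5 ^ (2 * (m + 1) + 2 * β + 2) + 5 ^ (2 * (m + 1)) + 1 =
      24 * (5 ^ (2 * (m + 1)) * o' + o) := by
    have h25 : 25 ^ (m + 1) = 5 ^ (2 * (m + 1)) := by
      rw [pow_mul]
      norm_num
    rw [h25] at ho
    rw [hpow]
    linear_combination -ho - 5 ^ (2 * (m + 1)) * ho'
  refine ⟨⟨_, hoff⟩, ?_⟩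
  rw [hoff, Nat.mul_div_cancel_left _ (by norm_num), hpow, ← Int.natCast_dvd_natCast,
    ← TwoColorPartition.coeff_partitionSeries_mul_expand _ (by positivity),
    show 5 ^ (2 * (m + 1)) * 25 ^ (β + 1) * n + (5 ^ (2 * (m + 1)) * o' + o) =
      5 ^ (2 * (m + 1)) * (25 ^ (β + 1) * n + o') + o by ring, ← hc, ← hc', ← coeff_succ_X_mul, hG]
  push_cast
  exact TwoColorPartition.dvd_coeff_of_mem_levelSpan hg _ _
end

section
/- For all integers j ≥ 1, k ≥ 1 and β ≥ 0, one has π(y^{(2k-1)}_{β+1,j}) ≥ 2k + β - 1 + ⌊(5j - 5)/2⌋. -/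
open PowerSeries


/-- The Hirschhorn–Hunt matrix `m_{i,j}` (zero outside `1 ≤ j ≤ i`). -/
def mcoef : ℕ → ℕ → ℤ
  | 1, 1 => 5
  | 2, 1 => 2 * 5
  | 2, 2 => 5 ^ 3
  | 3, 1 => 9
  | 3, 2 => 3 * 5 ^ 3
  | 3, 3 => 5 ^ 5
  | 4, 1 => 4
  | 4, 2 => 22 * 5 ^ 2
  | 4, 3 => 4 * 5 ^ 5
  | 4, 4 => 5 ^ 7
  | 5, 1 => 1
  | 5, 2 => 4 * 5 ^ 3
  | 5, 3 => 8 * 5 ^ 5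
  | 5, 4 => 5 ^ 8
  | 5, 5 => 5 ^ 9
  | i + 6, j + 2 =>
      25 * mcoef (i + 5) (j + 1) + 25 * mcoef (i + 4) (j + 1) +
        15 * mcoef (i + 3) (j + 1) + 5 * mcoef (i + 2) (j + 1) + mcoef (i + 1) (j + 1)
  | _, _ => 0

/-- The Hirschhorn–Hunt coefficient vectors: `xcoef k i = x_{k,i}`.
`x_1 = (5, 0, 0, …)` and `x_{k+1,i} = Σ_{j ≥ 1} x_{k,j} m_{6j,j+i}` for odd `k`,
`x_{k+1,i} = Σ_{j ≥ 1} x_{k,j} m_{6j+1,j+i}` for even `k` (the sums are finitely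
supported, and `∑ᶠ` sums over `j + 1` for `j : ℕ`, i.e. over all `j ≥ 1`). -/
noncomputable def xcoef : ℕ → ℕ → ℤ
  | 0, _ => 0
  | 1, j => if j = 1 then 5 else 0
  | k + 2, i =>
      if (k + 1) % 2 = 1 then
        ∑ᶠ j : ℕ, xcoef (k + 1) (j + 1) * mcoef (6 * (j + 1)) ((j + 1) + i)
      else
        ∑ᶠ j : ℕ, xcoef (k + 1) (j + 1) * mcoef (6 * (j + 1) + 1) ((j + 1) + i)

/-- `yodd k β j = y^{(2k-1)}_{β,j}`: `y^{(2k-1)}_{1,j} = x_{2k-1,j}` and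
`y^{(2k-1)}_{β+1,j} = Σ_{i ≥ 1} y^{(2k-1)}_{β,i} m_{6i+1,j+i}`. -/
noncomputable def yodd (k : ℕ) : ℕ → ℕ → ℤ
  | 0, _ => 0
  | 1, j => xcoef (2 * k - 1) j
  | β + 2, j => ∑ᶠ i : ℕ, yodd k (β + 1) (i + 1) * mcoef (6 * (i + 1) + 1) (j + (i + 1))

/-- The lower bound `⌊(5j - i - 1)/2⌋` for the `5`-adic valuation of `m_{i,j}`. -/
theorem pow_dvd_mcoef (i j : ℕ) : (5 : ℤ) ^ ((5 * j - i - 1) / 2) ∣ mcoef i j := by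
  induction i, j using mcoef.induct with
  | case16 i j h1 h2 h3 h4 h5 =>
    rw [mcoef]
    have step (c : ℤ) (e n : ℕ) (hc : (5 : ℤ) ^ e ∣ c)
        (hn : (5 : ℤ) ^ ((5 * (j + 1) - n - 1) / 2) ∣ mcoef n (j + 1))
        (hle : (5 * (j + 2) - (i + 6) - 1) / 2 ≤ e + (5 * (j + 1) - n - 1) / 2) :
        (5 : ℤ) ^ ((5 * (j + 2) - (i + 6) - 1) / 2) ∣ c * mcoef n (j + 1) :=
      (pow_dvd_pow 5 hle).trans (pow_add (5 : ℤ) _ _ ▸ mul_dvd_mul hc hn)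
    refine dvd_add (dvd_add (dvd_add (dvd_add ?_ ?_) ?_) ?_) ?_
    · exact step 25 2 _ (by norm_num) h1 (by omega)
    · exact step 25 2 _ (by norm_num) h2 (by omega)
    · exact step 15 1 _ (by norm_num) h3 (by omega)
    · exact step 5 1 _ (by norm_num) h4 (by omega)
    · simpa using step 1 0 _ (by norm_num) h5 (by omega)
  | case17 i j => rw [mcoef] <;> first | exact dvd_zero _ | assumption
  | _ => norm_num [mcoef]

theorem dvd_finsum {ι R : Type*} [CommSemiring R] {a : R} {f : ι → R} (h : ∀ i, a ∣ f i) :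
    a ∣ ∑ᶠ i, f i :=
  finsum_induction (a ∣ ·) (dvd_zero a) (fun _ _ => dvd_add) h

/-- A divisibility criterion for the sums `Σ_j w_j m_{r_j,c_j}`. -/
theorem pow_dvd_finsum_mul_mcoef {b r c : ℕ → ℕ} {w : ℕ → ℤ} {n : ℕ}
    (hw : ∀ j, (5 : ℤ) ^ b j ∣ w j)
    (hn : ∀ j, n ≤ b j + (5 * c j - r j - 1) / 2) :
    (5 : ℤ) ^ n ∣ ∑ᶠ j : ℕ, w j * mcoef (r j) (c j) :=
  dvd_finsum fun j => (pow_dvd_pow 5 (hn j)).trans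
    (pow_add (5 : ℤ) _ _ ▸ mul_dvd_mul (hw j) (pow_dvd_mcoef _ _))

theorem pow_dvd_xcoef_odd (k j : ℕ) (hj : 1 ≤ j) :
    (5 : ℤ) ^ (2 * k + 1 + (5 * j - 5) / 2) ∣ xcoef (2 * k + 1) j := by
  induction k generalizing j with
  | zero =>
    rw [xcoef]
    split_ifs with h
    · simp [h]
    · exact dvd_zero _
  | succ k ih =>
    have even (i : ℕ) (hi : 1 ≤ i) :
        (5 : ℤ) ^ (2 * k + 1 + (5 * i - 2) / 2) ∣ xcoef (2 * k + 2) i := by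
      rw [xcoef, if_pos (by omega)]
      exact pow_dvd_finsum_mul_mcoef (fun l => ih (l + 1) (by omega)) (fun l => by rcases l with _ | _ | l <;> omega)
    rw [show 2 * (k + 1) + 1 = (2 * k + 1) + 2 by ring, xcoef, if_neg (by omega)]
    exact pow_dvd_finsum_mul_mcoef (fun l => even (l + 1) (by omega)) (fun l => by rcases l with _ | _ | l <;> omega)

theorem pow_dvd_yodd (k β j : ℕ) (hk : 1 ≤ k) (hj : 1 ≤ j) :
    (5 : ℤ) ^ (2 * k + β - 1 + (5 * j - 5) / 2) ∣ yodd k (β + 1) j := by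
  induction β generalizing j with
  | zero =>
    obtain ⟨k, rfl⟩ := Nat.exists_eq_add_of_le' hk
    exact pow_dvd_xcoef_odd k j hj
  | succ β ih =>
    rw [yodd]
    exact pow_dvd_finsum_mul_mcoef (fun l => ih (l + 1) (by omega)) (fun l => by rcases l with _ | _ | l <;> omega)

/-- Lemma 4.3: `π(y^{(2k-1)}_{β+1,j}) ≥ 2k + β - 1 + ⌊(5j-5)/2⌋` where `π` is the
5-adic valuation (with `π(0) = +∞`). -/
theorem val_yodd (j k β : ℕ) (hj : 1 ≤ j) (hk : 1 ≤ k) :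
    ((2 * k + β - 1 + (5 * j - 5) / 2 : ℕ) : ℕ∞) ≤
      emultiplicity (5 : ℤ) (yodd k (β + 1) j) := by
  exact le_emultiplicity_of_pow_dvd (pow_dvd_yodd k β j hk hj)
end
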